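/- arXiv:2103.11665 — 3 statements merged into one kernel-verified Lean document; each statement's English description precedes it below -/
import Mathlib

section
/- Let q = r^2 with r ≡ 1 (mod 4). Suppose a, b are even divisors of q-1 with a ≡ 2 (mod 4), 2a | b(r+1), and 2b | a(r-1). For any even s with 1 ≤ s ≤ a/gcd(a,b) and any 1 ≤ t ≤ b/gcd(a,b), there exists a q-ary MDS Euclidean self-dual code of length n = s(q-1)/a + t(q-1)/b. -/
open Finset

variable {F : Type*} [Field F]

/-- `δ_A(aᵢ)` for a listed set `a : Fin n → F`. -/
noncomputable def delta {n : ℕ} (a : Fin n → F) (i : Fin n) : F :=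
  ∏ j ∈ Finset.univ.erase i, (a i - a j)

/-- `δ_S(x)` for a finite set `S ⊆ F`. -/
noncomputable def deltaSet [DecidableEq F] (S : Finset F) (x : F) : F :=
  ∏ y ∈ S.erase x, (x - y)

/-- Euclidean dual of a linear code. -/
def dualCode {n : ℕ} (C : Submodule F (Fin n → F)) : Submodule F (Fin n → F) where
  carrier := {x | ∀ y ∈ C, ∑ i, x i * y i = 0}
  add_mem' := by
    intro x y hx hy z hz
    simp [add_mul, Finset.sum_add_distrib, hx z hz, hy z hz]
  zero_mem' := by intro y hy; simp
  smul_mem' := by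
    intro c x hx y hy
    simp [smul_eq_mul, mul_assoc, ← Finset.mul_sum, hx y hy]

/-- Hamming weight. -/
noncomputable def wt {n : ℕ} (c : Fin n → F) : ℕ := Nat.card {i // c i ≠ 0}

/-- `C` is an `[n, k, n-k+1]` MDS code. -/
noncomputable def IsMDSCode {n : ℕ} (C : Submodule F (Fin n → F)) (k : ℕ) : Prop :=
  Module.finrank F C = k ∧ ∀ c ∈ C, c ≠ 0 → n - k + 1 ≤ wt c

noncomputable def GRSmap {n : ℕ} (a v : Fin n → F) : Polynomial F →ₗ[F] (Fin n → F) where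
  toFun f := fun i => v i * Polynomial.eval (a i) f
  map_add' f g := by funext i; simp [mul_add]
  map_smul' c f := by funext i; simp [Polynomial.eval_smul]; ring

/-- Generalized Reed–Solomon code `GRS_k(A, v)`. -/
noncomputable def GRS {n : ℕ} (k : ℕ) (a v : Fin n → F) : Submodule F (Fin n → F) :=
  Submodule.map (GRSmap a v) (Polynomial.degreeLT F k)

noncomputable def GRSextMap {n : ℕ} (k : ℕ) (a v : Fin n → F) :
    Polynomial F →ₗ[F] (Fin (n+1) → F) where
  toFun f := fun i =>
    if h : (i : ℕ) < n then v ⟨i, h⟩ * Polynomial.eval (a ⟨i, h⟩) f else f.coeff (k - 1)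
  map_add' f g := by
    funext i
    by_cases h : (i : ℕ) < n <;> simp [h, mul_add]
  map_smul' c f := by
    funext i
    by_cases h : (i : ℕ) < n <;> simp [h, Polynomial.eval_smul] <;> ring

/-- Extended generalized Reed–Solomon code `GRS_k(A ∪ {∞}, v)`. -/
noncomputable def GRSext {n : ℕ} (k : ℕ) (a v : Fin n → F) : Submodule F (Fin (n+1) → F) :=
  Submodule.map (GRSextMap k a v) (Polynomial.degreeLT F k)

open Polynomial

theorem finrank_GRS {n k : ℕ} {a v : Fin n → F} (ha : Function.Injective a)
    (hv : ∀ i, v i ≠ 0) (hk : k ≤ n) : Module.finrank F (GRS k a v) = k := by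
  have hinj : Function.Injective ((GRSmap a v).domRestrict (degreeLT F k)) := by
    rw [← LinearMap.ker_eq_bot, LinearMap.ker_eq_bot']
    rintro ⟨f, hf⟩ h
    rw [mem_degreeLT] at hf
    refine Subtype.ext (Polynomial.eq_zero_of_degree_lt_of_eval_index_eq_zero (s := univ) (v := a)
      ha.injOn (hf.trans_le ?_) fun i _ ↦ ?_)
    · rw [card_univ, Fintype.card_fin]
      exact_mod_cast hk
    have := congrFun h i
    simpa [GRSmap, hv i] using this
  rw [GRS, ← LinearMap.range_domRestrict, LinearMap.finrank_range_of_inj hinj,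
    (degreeLTEquiv F k).finrank_eq, Module.finrank_fin_fun]

theorem isMDSCode_GRS {n k : ℕ} {a v : Fin n → F} (ha : Function.Injective a)
    (hv : ∀ i, v i ≠ 0) (hk : k ≤ n) : IsMDSCode (GRS k a v) k := by
  classical
  refine ⟨finrank_GRS ha hv hk, ?_⟩
  rintro _ ⟨f, hf, rfl⟩ hne
  have hf0 : f ≠ 0 := by rintro rfl; simp at hne
  have hdeg : f.natDegree < k := by
    rw [natDegree_lt_iff_degree_lt hf0]; exact mem_degreeLT.1 hf
  have hwt : wt (GRSmap a v f) = #{i | f.eval (a i) ≠ 0} := by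
    rw [wt, Nat.card_eq_fintype_card, Fintype.card_subtype]
    simp [GRSmap, hv]
  have hzero : #{i | f.eval (a i) = 0} ≤ f.natDegree := by
    refine (card_le_card_of_injOn a (t := f.roots.toFinset) ?_ ha.injOn).trans
      ((Multiset.toFinset_card_le _).trans f.card_roots')
    intro i hi
    simp_all
  have hsum := card_filter_add_card_filter_not (s := (univ : Finset (Fin n)))
    (fun i ↦ f.eval (a i) = 0)
  simp only [card_univ, Fintype.card_fin] at hsum
  rw [hwt]
  simp only [ne_eq]
  omega

theorem GRS_eq_dualCode {n : ℕ} (hn : Even n) {a v : Fin n → F} {c : F}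
    (ha : Function.Injective a) (hc : c ≠ 0) (hv : ∀ i, v i ^ 2 * delta a i = c) :
    GRS (n / 2) a v = dualCode (GRS (n / 2) a v) := by
  classical
  have hv0 : ∀ i, v i ≠ 0 := fun i h ↦ hc (by rw [← hv i, h]; simp)
  have hd0 : ∀ i, delta a i ≠ 0 := fun i h ↦ hc (by rw [← hv i, h]; simp)
  obtain ⟨k, rfl⟩ := hn
  rw [show (k + k) / 2 = k by omega]
  have hpair (f g : F[X]) (hfg : (f * g).degree < (k + k : ℕ)) :
      ∑ i, GRSmap a v f i * GRSmap a v g i = c * (f * g).coeff (k + k - 1) := by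
    have h := Lagrange.coeff_eq_sum (s := univ) (v := a) ha.injOn (P := f * g) (by simpa using hfg)
    rw [card_univ, Fintype.card_fin] at h
    rw [h, mul_sum]
    refine sum_congr rfl fun i _ ↦ ?_
    change _ = c * (_ / delta a i)
    rw [← hv i, eval_mul]
    field_simp [hd0 i]
    simp [GRSmap]
    ring
  ext x
  constructor
  · rintro ⟨f, hf, rfl⟩ _ ⟨g, hg, rfl⟩
    have hf := mem_degreeLT.1 hf
    have hg := mem_degreeLT.1 hg
    by_cases h0 : f * g = 0
    · rw [hpair _ _ (by rw [h0, degree_zero]; exact WithBot.bot_lt_coe _), h0]; simp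
    have hf0 : f ≠ 0 := left_ne_zero_of_mul h0
    have hg0 : g ≠ 0 := right_ne_zero_of_mul h0
    rw [← natDegree_lt_iff_degree_lt hf0] at hf
    rw [← natDegree_lt_iff_degree_lt hg0] at hg
    have hfg := natDegree_mul hf0 hg0
    rw [hpair _ _ ((natDegree_lt_iff_degree_lt h0).1 (by omega)),
      coeff_eq_zero_of_natDegree_lt (by omega), mul_zero]
  · intro hx
    set f := Lagrange.interpolate univ a fun i ↦ x i / v i with hf
    have hfdeg : f.degree < (k + k : ℕ) := by
      have h := Lagrange.degree_interpolate_lt (s := univ) (fun i ↦ x i / v i) ha.injOn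
      rwa [card_univ, Fintype.card_fin] at h
    have hxf : GRSmap a v f = x := by
      ext i
      simp only [GRSmap, LinearMap.coe_mk, AddHom.coe_mk, hf,
        Lagrange.eval_interpolate_at_node _ ha.injOn (mem_univ i)]
      field_simp [hv0 i]
    refine ⟨f, ?_, hxf⟩
    by_contra hcon
    have hf0 : f ≠ 0 := by
      rintro h
      exact hcon (by rw [h]; exact zero_mem _)
    have hlow : k ≤ f.natDegree := by
      by_contra! h
      exact hcon (mem_degreeLT.2 ((natDegree_lt_iff_degree_lt hf0).1 h))
    rw [← natDegree_lt_iff_degree_lt hf0] at hfdeg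
    have hX : (X ^ (k + k - 1 - f.natDegree) : F[X]) ∈ degreeLT F k :=
      mem_degreeLT.2 (by rw [degree_X_pow]; exact_mod_cast (by omega))
    have h := hx _ ⟨_, hX, rfl⟩
    have hne : f * X ^ (k + k - 1 - f.natDegree) ≠ 0 := mul_ne_zero hf0 (pow_ne_zero _ X_ne_zero)
    have hdeg := natDegree_mul_X_pow (k + k - 1 - f.natDegree) hf0
    rw [← hxf, hpair _ _ ((natDegree_lt_iff_degree_lt hne).1 (by omega)),
      coeff_mul_X_pow', if_pos (by omega),
      show k + k - 1 - (k + k - 1 - f.natDegree) = f.natDegree by omega] at h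
    simp [hc, hf0] at h

/-- A monic split polynomial of even degree whose derivative takes only non-square values at its
roots yields a self-dual MDS code supported on these roots. -/
theorem exists_selfDual_of_derivative_pow_eq_neg_one [Fintype F] (hF : ringChar F ≠ 2) {T : F[X]}
    (hT : T.Monic) (hs : T.Splits) {n : ℕ} (hn : T.natDegree = n) (hne : Even n)
    (h : ∀ x, T.IsRoot x → (T.derivative.eval x) ^ (Fintype.card F / 2) = -1) :
    ∃ C : Submodule F (Fin n → F), IsMDSCode C (n / 2) ∧ C = dualCode C := by
  classical
  have hq : Fintype.card F / 2 ≠ 0 := by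
    have := Fintype.one_lt_card (α := F)
    omega
  have hd0 (x) (hx : T.IsRoot x) : T.derivative.eval x ≠ 0 := by
    intro h0
    have := h x hx
    simp [h0, hq] at this
  have hnodup : T.roots.Nodup := by
    rw [Multiset.nodup_iff_count_le_one]
    intro x
    by_contra! hx
    rw [count_roots, one_lt_rootMultiplicity_iff_isRoot hT.ne_zero] at hx
    exact hd0 x hx.1 hx.2
  have hcard : #T.roots.toFinset = n := by
    rw [Multiset.toFinset_card_of_nodup hnodup, ← hs.natDegree_eq_card_roots, hn]
  let e := T.roots.toFinset.equivFinOfCardEq hcard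
  let a : Fin n → F := fun i ↦ (e.symm i : F)
  have ha : Function.Injective a := Subtype.val_injective.comp e.symm.injective
  have hroot (i) : T.IsRoot (a i) := by
    have := (e.symm i).2
    rw [Multiset.mem_toFinset] at this
    exact isRoot_of_mem_roots this
  have hnodal : T = Lagrange.nodal univ a := by
    conv_lhs => rw [hs.eq_prod_roots_of_monic hT]
    rw [Lagrange.nodal, ← Multiset.toFinset_val T.roots |>.trans hnodup.dedup]
    change ∏ x ∈ T.roots.toFinset, (X - C x) = _
    rw [← prod_coe_sort]
    exact (Equiv.prod_comp e.symm fun x : T.roots.toFinset ↦ (X - C (x : F))).symm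
  have hdelta (i) : T.derivative.eval (a i) = delta a i := by
    conv_lhs => rw [hnodal]
    rw [Lagrange.eval_nodal_derivative_eval_node_eq (mem_univ i), Lagrange.eval_nodal, delta]
  obtain ⟨c, hc⟩ := FiniteField.exists_nonsquare hF
  have hc0 : c ≠ 0 := by rintro rfl; exact hc (by simp)
  have hcp : c ^ (Fintype.card F / 2) = -1 :=
    (FiniteField.pow_dichotomy hF hc0).resolve_left fun h ↦ hc ((FiniteField.isSquare_iff hF hc0).2 h)
  have hsq (i) : ∃ w, w ^ 2 * delta a i = c := by
    have hd := hd0 _ (hroot i)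
    have hi := h _ (hroot i)
    rw [hdelta] at hd hi
    have : IsSquare (c / delta a i) := by
      rw [FiniteField.isSquare_iff hF (div_ne_zero hc0 hd), div_pow, hcp, hi]
      norm_num
    obtain ⟨w, hw⟩ := this
    exact ⟨w, by rw [sq, ← hw]; field_simp⟩
  choose v hv using hsq
  refine ⟨GRS (n / 2) a v, isMDSCode_GRS ha ?_ (by omega), GRS_eq_dualCode hne ha hc0 hv⟩
  intro i hi
  exact hc0 (by rw [← hv i, hi]; simp)

theorem eval_derivative_prod_X_pow_sub_C {s m i : ℕ} {u : ℕ → F} (hi : i ∈ range s) {x : F}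
    (hx : x ^ m = u i) :
    (derivative (∏ j ∈ range s, (X ^ m - C (u j)))).eval x =
      (∏ j ∈ (range s).erase i, (u i - u j)) * (m * x ^ (m - 1)) := by
  have hcomp : ∏ j ∈ range s, (X ^ m - C (u j)) = (Lagrange.nodal (range s) u).comp (X ^ m) := by
    simp [Lagrange.nodal, Polynomial.prod_comp]
  rw [hcomp, derivative_comp, eval_mul, eval_comp, eval_pow, eval_X, hx,
    Lagrange.eval_nodal_derivative_eval_node_eq hi, Lagrange.eval_nodal]
  rw [derivative_X_pow]
  simp [mul_comm]

theorem sub_pow_pred_eq_one {r : ℕ} (hr : 1 ≤ r) (φ : F →+* F) (hφ : ∀ x, φ x = x ^ r) {y z : F}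
    (hy : y ^ (r - 1) = 1) (hz : z ^ (r - 1) = 1) (hyz : y ≠ z) : (y - z) ^ (r - 1) = 1 := by
  have hfix {w : F} (hw : w ^ (r - 1) = 1) : φ w = w := by
    rw [hφ, ← Nat.sub_add_cancel hr, pow_succ, hw, one_mul]
  refine mul_right_cancel₀ (sub_ne_zero.2 hyz) ?_
  rw [← pow_succ, Nat.sub_add_cancel hr, ← hφ, map_sub, hfix hy, hfix hz, one_mul]

theorem sub_pow_pred_mul_eq_neg_one {r : ℕ} (hr : 1 ≤ r) (φ : F →+* F) (hφ : ∀ x, φ x = x ^ r)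
    {y z : F} (hy : y ^ (r + 1) = 1) (hz : z ^ (r + 1) = 1) (hyz : y ≠ z) :
    (y - z) ^ (r - 1) * (y * z) = -1 := by
  have hinv {w : F} (hw : w ^ (r + 1) = 1) : φ w * w = 1 := by rw [hφ, ← pow_succ, hw]
  refine mul_right_cancel₀ (sub_ne_zero.2 hyz) ?_
  calc (y - z) ^ (r - 1) * (y * z) * (y - z)
      = (y - z) ^ (r - 1 + 1) * (y * z) := by ring
    _ = (φ y * y) * z - (φ z * z) * y := by
      rw [Nat.sub_add_cancel hr, ← hφ, map_sub]; ring
    _ = -1 * (y - z) := by rw [hinv hy, hinv hz]; ring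

theorem natCast_pow_pred_eq_one {r : ℕ} (hr : 1 ≤ r) (φ : F →+* F) (hφ : ∀ x, φ x = x ^ r)
    {m : ℕ} (hm : (m : F) ≠ 0) : (m : F) ^ (r - 1) = 1 := by
  refine mul_right_cancel₀ hm ?_
  rw [← pow_succ, Nat.sub_add_cancel hr, ← hφ, map_natCast, one_mul]

/-- The product of `s` polynomials `X ^ m - u j` and `t` polynomials `X ^ l - w j`, where the `u j`
are squares of norm-one elements and the `w j` lie in the subfield of order `r`, has only
non-square derivative values at its roots. -/
theorem derivative_eval_pow_eq_neg_one {r k N m l s t : ℕ} (hrk : r = 4 * k + 1)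
    (hN : N = (r - 1) * (2 * k + 1)) (φ : F →+* F) (hφ : ∀ x, φ x = x ^ r)
    (hm0 : (m : F) ≠ 0) (hl0 : (l : F) ≠ 0) (hl : Even l) (hs : Even s) (hs0 : s ≠ 0)
    {u w : ℕ → F} (hu : Set.InjOn u (range s)) (hw : Set.InjOn w (range t))
    (hu1 : ∀ i, u i ^ (2 * k + 1) = 1) (hw1 : ∀ j, w j ^ (r - 1) = 1)
    (hxu : ∀ x i, x ^ m = u i → x ^ N = 1 ∧ (x ^ l) ^ (r - 1) = 1)
    (hxw : ∀ x j, x ^ l = w j → x ^ N = -1 ∧ (x ^ m) ^ (r + 1) = 1) (h2 : (-1 : F) ≠ 1) (x : F)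
    (hx : ((∏ i ∈ range s, (X ^ m - C (u i))) * ∏ j ∈ range t, (X ^ l - C (w j))).IsRoot x) :
    ((derivative ((∏ i ∈ range s, (X ^ m - C (u i))) *
      ∏ j ∈ range t, (X ^ l - C (w j)))).eval x) ^ N = -1 := by
  have hr : 1 ≤ r := by omega
  have hdisj (i j) (hi : x ^ m = u i) (hj : x ^ l = w j) : False :=
    h2 ((hxw x j hj).1.symm.trans (hxu x i hi).1)
  have hsub {y z : F} (hy : y ^ (r - 1) = 1) (hz : z ^ (r - 1) = 1) (hyz : y ≠ z) :
      (y - z) ^ N = 1 := by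
    rw [hN, pow_mul, sub_pow_pred_eq_one hr φ hφ hy hz hyz, one_pow]
  have hnat {m : ℕ} (hm : (m : F) ≠ 0) : (m : F) ^ N = 1 := by
    rw [hN, pow_mul, natCast_pow_pred_eq_one hr φ hφ hm, one_pow]
  have hu2 (i) : u i ^ (r + 1) = 1 := by
    rw [show r + 1 = (2 * k + 1) * 2 by omega, pow_mul, hu1, one_pow]
  have hsubu {y : F} (i) (hy : y ^ (r + 1) = 1) (hyu : y ≠ u i) :
      (y - u i) ^ N * y ^ (2 * k + 1) = -1 := by
    have h := congrArg (· ^ (2 * k + 1)) (sub_pow_pred_mul_eq_neg_one hr φ hφ hy (hu2 i) hyu)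
    simpa only [mul_pow, hu1, mul_one, ← pow_mul, ← hN, (odd_two_mul_add_one k).neg_one_pow] using h
  rw [IsRoot.def, eval_mul, mul_eq_zero] at hx
  simp only [eval_prod, eval_sub, eval_pow, eval_X, eval_C, prod_eq_zero_iff, sub_eq_zero] at hx
  rcases hx with ⟨i, hi, hxi⟩ | ⟨j, hj, hxj⟩
  · obtain ⟨hxN, hxl⟩ := hxu x i hxi
    have hP : eval x (∏ i ∈ range s, (X ^ m - C (u i))) = 0 := by
      simp only [eval_prod, eval_sub, eval_pow, eval_X, eval_C, prod_eq_zero_iff, sub_eq_zero]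
      exact ⟨i, hi, hxi⟩
    have hQ : (eval x (∏ j ∈ range t, (X ^ l - C (w j)))) ^ N = 1 := by
      simp only [eval_prod, eval_sub, eval_pow, eval_X, eval_C, ← prod_pow]
      exact prod_eq_one fun j _ ↦ hsub hxl (hw1 j) fun h ↦ hdisj i j hxi h
    have hu' : ∏ j ∈ (range s).erase i, (u i - u j) ^ N = -1 := by
      rw [prod_congr rfl fun j hj ↦ ?_, prod_const (-1 : F), card_erase_of_mem hi, card_range]
      · exact (Nat.Even.sub_odd (by omega) hs odd_one).neg_one_pow
      · rw [mem_erase] at hj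
        simpa [hu1] using hsubu j (hu2 i) fun h ↦ hj.1 (hu hi hj.2 h).symm
    rw [derivative_mul, eval_add, eval_mul, eval_mul, hP, zero_mul, add_zero, mul_pow, hQ,
      eval_derivative_prod_X_pow_sub_C hi hxi, mul_pow, mul_pow, ← prod_pow, hu', hnat hm0,
      ← pow_mul, mul_comm (m - 1), pow_mul, hxN]
    simp
  · obtain ⟨hxN, hxm⟩ := hxw x j hxj
    have hQ : eval x (∏ j ∈ range t, (X ^ l - C (w j))) = 0 := by
      simp only [eval_prod, eval_sub, eval_pow, eval_X, eval_C, prod_eq_zero_iff, sub_eq_zero]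
      exact ⟨j, hj, hxj⟩
    have hP : (eval x (∏ i ∈ range s, (X ^ m - C (u i)))) ^ N = 1 := by
      simp only [eval_prod, eval_sub, eval_pow, eval_X, eval_C, ← prod_pow]
      have h : ∏ i ∈ range s, ((x ^ m - u i) ^ N * (x ^ m) ^ (2 * k + 1)) = 1 := by
        rw [prod_congr rfl fun i _ ↦ hsubu i hxm fun h ↦ hdisj i j h hxj, prod_const, card_range,
          hs.neg_one_pow]
      obtain ⟨s', rfl⟩ := hs
      rwa [prod_mul_distrib, prod_const, card_range, ← pow_mul,
        show (2 * k + 1) * (s' + s') = (r + 1) * s' by rw [hrk]; ring, pow_mul (x ^ m), hxm,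
        one_pow, mul_one] at h
    have hw' : ∏ i ∈ (range t).erase j, (w j - w i) ^ N = 1 := by
      refine prod_eq_one fun i hi ↦ ?_
      rw [mem_erase] at hi
      exact hsub (hw1 j) (hw1 i) fun h ↦ hi.1 (hw hj hi.2 h).symm
    have hl1 : Odd (l - 1) := by
      have : l ≠ 0 := by rintro rfl; simp at hl0
      exact Nat.Even.sub_odd (by omega) hl odd_one
    rw [derivative_mul, eval_add, eval_mul, eval_mul, hQ, mul_zero, zero_add, mul_pow, hP,
      eval_derivative_prod_X_pow_sub_C hj hxj, mul_pow, mul_pow, ← prod_pow, hw', hnat hl0,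
      ← pow_mul, mul_comm (l - 1), pow_mul, hxN, hl1.neg_one_pow]
    simp

/-- The arithmetic of the exponents: for `h = gcd a b / 2`, the numbers `h * l` and `h * m` are
multiples of `r + 1` and `r - 1`. -/
theorem exponent_arithmetic {k a b m l : ℕ} (hk : 0 < k) (ha4 : a % 4 = 2) (hbe : Even b)
    (hma : m * a = 4 * k * (4 * k + 2)) (hlb : l * b = 4 * k * (4 * k + 2))
    (hab : 2 * a ∣ b * (4 * k + 2)) (hba : 2 * b ∣ a * (4 * k)) :
    ∃ h A B c c', Nat.gcd a b = 2 * h ∧ Odd h ∧ h * l = (4 * k + 2) * A ∧ h * m = 4 * k * B ∧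
      l * (4 * k) = m * (2 * c) ∧ m * (4 * k + 2) = l * (2 * c') := by
  have hb0 : 0 < b := Nat.pos_of_ne_zero (by rintro rfl; simp at hlb; omega)
  obtain ⟨c, hc⟩ := hba
  obtain ⟨c', hc'⟩ := hab
  have hal : a * l = 2 * (4 * k + 2) * c := by
    refine Nat.eq_of_mul_eq_mul_right (show 0 < 4 * k by omega) ?_
    linear_combination l * hc + 2 * c * hlb
  have hbm : b * m = 2 * (4 * k) * c' := by
    refine Nat.eq_of_mul_eq_mul_right (show 0 < 4 * k + 2 by omega) ?_
    linear_combination m * hc' + 2 * c' * hma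
  have hd2 : 2 ∣ Nat.gcd a b := Nat.dvd_gcd (by omega) hbe.two_dvd
  obtain ⟨h, hh⟩ := hd2
  have hdl : 2 * (4 * k + 2) ∣ Nat.gcd a b * l := by
    rw [← Nat.gcd_mul_right]
    exact Nat.dvd_gcd ⟨c, hal⟩ ⟨2 * k, by rw [mul_comm b, hlb]; ring⟩
  have hdm : 2 * (4 * k) ∣ Nat.gcd a b * m := by
    rw [← Nat.gcd_mul_right]
    exact Nat.dvd_gcd ⟨2 * k + 1, by rw [mul_comm a, hma]; ring⟩ ⟨c', hbm⟩
  rw [hh, mul_assoc] at hdl hdm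
  obtain ⟨A, hA⟩ := Nat.dvd_of_mul_dvd_mul_left two_pos hdl
  obtain ⟨B, hB⟩ := Nat.dvd_of_mul_dvd_mul_left two_pos hdm
  refine ⟨h, A, B, c, c', hh, ?_, hA, hB, ?_, ?_⟩
  · obtain ⟨e, he⟩ := Nat.gcd_dvd_left a b
    rw [hh] at he
    rw [← Nat.not_even_iff_odd]
    rintro ⟨h', rfl⟩
    have : a = 4 * (h' * e) := by rw [he]; ring
    omega
  · refine Nat.eq_of_mul_eq_mul_right (show 0 < 4 * k + 2 by omega) ?_
    linear_combination m * hal - l * hma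
  · refine Nat.eq_of_mul_eq_mul_right (show 0 < 4 * k by omega) ?_
    linear_combination l * hbm - m * hlb

theorem exists_ringHom_eq_pow [Fintype F] {r : ℕ} (hr : IsPrimePow r)
    (hq : Fintype.card F = r ^ 2) : ∃ φ : F →+* F, ∀ x, φ x = x ^ r := by
  obtain ⟨p, e, hp, he, rfl⟩ := hr
  have hp := hp.nat_prime
  have : Fact p.Prime := ⟨hp⟩
  obtain ⟨p', hp'⟩ := CharP.exists F
  have : Fact p'.Prime := ⟨CharP.char_is_prime F p'⟩
  obtain ⟨n, -, hn⟩ := FiniteField.card F p'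
  have hpp : p' = p := by
    have h1 : p' ∣ (p ^ e) ^ 2 := by rw [← hq, hn]; exact dvd_pow_self _ n.ne_zero
    exact (Nat.prime_dvd_prime_iff_eq Fact.out hp).1
      (Nat.Prime.dvd_of_dvd_pow Fact.out (Nat.Prime.dvd_of_dvd_pow Fact.out h1))
  subst hpp
  exact ⟨iterateFrobenius F p' e, fun x ↦ iterateFrobenius_def ..⟩

theorem exists_isPrimitiveRoot_card_sub_one (F : Type*) [Field F] [Fintype F] :
    ∃ g : F, IsPrimitiveRoot g (Fintype.card F - 1) := by
  classical
  obtain ⟨g, hg⟩ := IsCyclic.exists_ofOrder_eq_natCard (α := Fˣ)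
  refine ⟨g, IsPrimitiveRoot.coe_units_iff.2 ?_⟩
  rw [IsPrimitiveRoot.iff_orderOf, hg, Nat.card_eq_fintype_card, Fintype.card_units]

theorem natDegree_prod_X_pow_sub_C {s m : ℕ} (hm : m ≠ 0) (u : ℕ → F) :
    (∏ i ∈ range s, (X ^ m - C (u i))).natDegree = s * m := by
  rw [natDegree_prod_of_monic _ _ fun i _ ↦ monic_X_pow_sub_C _ hm]
  simp

/-- Theorem 1(i): `q = r²`, `r ≡ 1 (mod 4)`, `a, b` even divisors of `q-1`, `a ≡ 2 (mod 4)`,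
`2a ∣ b(r+1)`, `2b ∣ a(r-1)`, `s` even with `1 ≤ s ≤ a/gcd(a,b)`, `1 ≤ t ≤ b/gcd(a,b)`:
there exists a `q`-ary MDS Euclidean self-dual code of length `n = s(q-1)/a + t(q-1)/b`. -/
theorem stmt12 {F : Type*} [Field F] [Fintype F] {q r : ℕ} (hq : Fintype.card F = q)
    (hq2 : q = r ^ 2) (hpp : IsPrimePow r) (hr4 : r % 4 = 1)
    {a b : ℕ} (hae : Even a) (hbe : Even b) (ha : a ∣ q - 1) (hb : b ∣ q - 1)
    (ha4 : a % 4 = 2) (hab : 2 * a ∣ b * (r + 1)) (hba : 2 * b ∣ a * (r - 1))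
    {s t : ℕ} (hs : Even s) (hs1 : 1 ≤ s) (hs2 : s ≤ a / Nat.gcd a b)
    (ht1 : 1 ≤ t) (ht2 : t ≤ b / Nat.gcd a b) :
    ∃ C : Submodule F (Fin (s * ((q - 1) / a) + t * ((q - 1) / b)) → F),
      IsMDSCode C ((s * ((q - 1) / a) + t * ((q - 1) / b)) / 2) ∧ C = dualCode C := by
  obtain ⟨k, rfl⟩ : ∃ k, r = 4 * k + 1 := ⟨r / 4, by omega⟩
  have hk : 0 < k := by
    have := hpp.one_lt
    omega
  have hQ : q - 1 = 4 * k * (4 * k + 2) := by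
    rw [hq2, show (4 * k + 1) ^ 2 = 4 * k * (4 * k + 2) + 1 by ring, Nat.add_sub_cancel]
  have hQ0 : 0 < q - 1 := by rw [hQ]; positivity
  have hcard2 : Fintype.card F / 2 = 4 * k * (2 * k + 1) := by
    rw [hq, hq2, show (4 * k + 1) ^ 2 = 2 * (4 * k * (2 * k + 1)) + 1 by ring]
    omega
  obtain ⟨φ, hφ⟩ := exists_ringHom_eq_pow hpp (hq.trans hq2)
  obtain ⟨g, hg⟩ := exists_isPrimitiveRoot_card_sub_one F
  rw [hq] at hg
  have hchar : ringChar F ≠ 2 := by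
    intro h
    have := FiniteField.even_card_of_char_two h
    rw [hq, hq2, show (4 * k + 1) ^ 2 = 2 * (4 * k * (2 * k + 1)) + 1 by ring] at this
    omega
  have hneg : (-1 : F) ≠ 1 := Ring.neg_one_ne_one_of_char_ne_two hchar
  have hma : (q - 1) / a * a = q - 1 := Nat.div_mul_cancel ha
  have hlb : (q - 1) / b * b = q - 1 := Nat.div_mul_cancel hb
  generalize (q - 1) / a = m at hma ⊢
  generalize (q - 1) / b = l at hlb ⊢
  have hcast (m a : ℕ) (h : m * a = q - 1) : (m : F) ≠ 0 := by
    intro hm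
    have h1 : ((m * a + 1 : ℕ) : F) = 0 := by
      rw [h, Nat.sub_add_cancel (by omega), ← hq]
      exact FiniteField.cast_card_eq_zero F
    simp [hm] at h1
  have hm0 := hcast m a hma
  have hl0 := hcast l b hlb
  have hmpos : 0 < m := Nat.pos_of_ne_zero (by rintro rfl; simp at hm0)
  have hlpos : 0 < l := Nat.pos_of_ne_zero (by rintro rfl; simp at hl0)
  have hroot_a : IsPrimitiveRoot (g ^ a) m := hg.pow hQ0 (by rw [← hma, mul_comm])
  have hroot_b : IsPrimitiveRoot (g ^ b) l := hg.pow hQ0 (by rw [← hlb, mul_comm])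
  have hgQ : g ^ (4 * k * (4 * k + 2)) = 1 := by rw [← hQ]; exact hg.pow_eq_one
  have hgN : g ^ (4 * k * (2 * k + 1)) = -1 := by
    rw [← hcard2]
    refine (FiniteField.pow_dichotomy hchar (hg.ne_zero hQ0.ne')).resolve_left fun h ↦ ?_
    have hle := Nat.le_of_dvd (by rw [hcard2]; positivity) (hg.dvd_of_pow_eq_one _ h)
    rw [hcard2, hQ] at hle
    nlinarith
  obtain ⟨h, A, B, c, c', hd, hodd, hhl, hhm, hlr, hmr⟩ :=
    exponent_arithmetic hk ha4 hbe (hma.trans hQ) (hlb.trans hQ) hab hba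
  have hl : Even l := by
    refine (Nat.even_mul.1 (hhl ▸ ?_ : Even (h * l))).resolve_left (Nat.not_even_iff_odd.2 hodd)
    exact Even.mul_right ⟨2 * k + 1, by ring⟩ _
  have hm : Even m := by
    refine (Nat.even_mul.1 (hhm ▸ ?_ : Even (h * m))).resolve_left (Nat.not_even_iff_odd.2 hodd)
    exact Even.mul_right ⟨2 * k, by ring⟩ _
  have hone {e : ℕ} (y : ℕ) (he : e = 4 * k * (4 * k + 2) * y) : g ^ e = 1 := by
    rw [he, pow_mul, hgQ, one_pow]
  let u : ℕ → F := fun i ↦ (g ^ (2 * h * i)) ^ m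
  let w : ℕ → F := fun j ↦ (g ^ ((2 * j + 1) * h)) ^ l
  have hh0 : 0 < h := hodd.pos
  rw [hd] at hs2 ht2
  have hu : Set.InjOn u (range s) := by
    have hlt {i} (hi : i < s) : 2 * h * i * m < q - 1 := by
      have h1 := (Nat.mul_le_mul_left _ hs2).trans (Nat.mul_div_le a (2 * h))
      have h2 : 2 * h * i < 2 * h * s := Nat.mul_lt_mul_of_pos_left hi (by positivity)
      rw [← hma, mul_comm m]
      exact Nat.mul_lt_mul_of_pos_right (h2.trans_le h1) hmpos
    intro i hi j hj hij
    rw [coe_range, Set.mem_Iio] at hi hj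
    simp only [u, ← pow_mul] at hij
    have := hg.pow_inj (hlt hi) (hlt hj) hij
    exact Nat.eq_of_mul_eq_mul_left (by positivity) (Nat.eq_of_mul_eq_mul_right hmpos this)
  have hw : Set.InjOn w (range t) := by
    have hlt {i} (hi : i < t) : (2 * i + 1) * h * l < q - 1 := by
      have h1 := (Nat.mul_le_mul_left _ ht2).trans (Nat.mul_div_le b (2 * h))
      have h2 : (2 * i + 1) * h < 2 * h * t := by nlinarith
      rw [← hlb, mul_comm l]
      exact Nat.mul_lt_mul_of_pos_right (h2.trans_le h1) hlpos
    intro i hi j hj hij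
    rw [coe_range, Set.mem_Iio] at hi hj
    simp only [w, ← pow_mul] at hij
    have := Nat.eq_of_mul_eq_mul_right hh0 (Nat.eq_of_mul_eq_mul_right hlpos
      (hg.pow_inj (hlt hi) (hlt hj) hij))
    omega
  obtain ⟨a', rfl⟩ := hae.two_dvd
  obtain ⟨b', rfl⟩ := hbe.two_dvd
  have hma' : m * a' = 4 * k * (2 * k + 1) := by linarith [hma.trans hQ]
  have hlb' : l * b' = 4 * k * (2 * k + 1) := by linarith [hlb.trans hQ]
  have hmonic : ((∏ i ∈ range s, (X ^ m - C (u i))) * ∏ j ∈ range t, (X ^ l - C (w j))).Monic :=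
    (monic_prod_of_monic _ _ fun i _ ↦ monic_X_pow_sub_C _ hmpos.ne').mul
      (monic_prod_of_monic _ _ fun i _ ↦ monic_X_pow_sub_C _ hlpos.ne')
  refine exists_selfDual_of_derivative_pow_eq_neg_one hchar hmonic
    (.mul (.prod fun i _ ↦ X_pow_sub_C_splits_of_isPrimitiveRoot hroot_a rfl)
      (.prod fun j _ ↦ X_pow_sub_C_splits_of_isPrimitiveRoot hroot_b rfl)) ?_
    ((hm.mul_left s).add (hl.mul_left t)) ?_
  · rw [Monic.natDegree_mul (monic_prod_of_monic _ _ fun i _ ↦ monic_X_pow_sub_C _ hmpos.ne')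
      (monic_prod_of_monic _ _ fun i _ ↦ monic_X_pow_sub_C _ hlpos.ne'),
      natDegree_prod_X_pow_sub_C hmpos.ne', natDegree_prod_X_pow_sub_C hlpos.ne']
  · refine derivative_eval_pow_eq_neg_one (k := k) rfl hcard2 φ hφ hm0 hl0 hl hs (by omega) hu hw
      ?_ ?_ ?_ ?_ hneg
    · intro i
      simp only [u, ← pow_mul]
      exact hone (i * B) (by linear_combination 2 * i * (2 * k + 1) * hhm)
    · intro j
      simp only [w, ← pow_mul, Nat.add_sub_cancel]
      exact hone ((2 * j + 1) * A) (by linear_combination (2 * j + 1) * 4 * k * hhl)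
    · intro x i hx
      simp only [u] at hx
      constructor
      · rw [hcard2, ← hma', pow_mul, hx, ← pow_mul, ← pow_mul]
        exact hone (h * i) (by linear_combination 2 * h * i * hma')
      · rw [← pow_mul, Nat.add_sub_cancel, hlr, pow_mul, hx, ← pow_mul, ← pow_mul]
        exact hone (2 * i * A)
          (by linear_combination 2 * i * 4 * k * hhl - 2 * h * i * hlr)
    · intro x j hx
      simp only [w] at hx
      constructor
      · rw [hcard2, ← hlb', pow_mul, hx, ← pow_mul, ← pow_mul, hlb',
          mul_comm, pow_mul, hgN, ((odd_two_mul_add_one j).mul hodd).neg_one_pow]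
      · rw [← pow_mul, show 4 * k + 1 + 1 = 4 * k + 2 by rfl, hmr, pow_mul, hx, ← pow_mul,
          ← pow_mul]
        exact hone ((2 * j + 1) * B)
          (by linear_combination (2 * j + 1) * (4 * k + 2) * hhm - (2 * j + 1) * h * hmr)
end

section
/- Let q = r^2 with r ≡ 3 (mod 4). Suppose a, b are even divisors of q-1 with b ≡ 2 (mod 4), 2a | b(r+1), and 2b | a(r-1). If 1 ≤ s ≤ a/gcd(a,b), 1 ≤ t ≤ b/gcd(a,b), and (r+1)b s²/(2a) is even, then there exists a q-ary MDS Euclidean self-dual code of length n + 2 where n = s(q-1)/a + t(q-1)/b. -/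
open Finset

variable {F : Type*} [Field F]

/-- A self-orthogonal linear code of half the length is self-dual. -/
theorem eq_dualCode_of_le_of_finrank {K : Type*} [Field K] {n k : ℕ}
    (C : Submodule K (Fin n → K)) (hle : C ≤ dualCode C)
    (hC : Module.finrank K C = k) (hn : n = 2 * k) : C = dualCode C := by
  let B : LinearMap.BilinForm K (Fin n → K) := dotProductBilin K K
  have hrefl : B.IsRefl := fun x y h => by
    simpa [B, dotProductBilin, dotProduct_comm] using h
  have hB : B.Nondegenerate := by
    refine hrefl.nondegenerate_iff_separatingLeft.2 fun x hx => ?_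
    exact dotProduct_eq_zero x fun y => by simpa [B, dotProductBilin] using hx y
  have hd : dualCode C = B.orthogonal C := by
    ext x
    simp only [LinearMap.BilinForm.mem_orthogonal_iff]
    refine forall₂_congr fun y _ => ?_
    simp [B, dotProductBilin, dotProduct, mul_comm]
  refine Submodule.eq_of_le_of_finrank_eq hle ?_
  rw [hd, LinearMap.BilinForm.finrank_orthogonal hB, hC]
  simp [hn]
  omega

open Polynomial in
theorem mem_GRSext_iff {K : Type*} [Field K] {n k : ℕ} {a v : Fin n → K}
    {c : Fin (n + 1) → K} :
    c ∈ GRSext k a v ↔ ∃ f ∈ degreeLT K k, (∀ i : Fin n, c i.castSucc = v i * f.eval (a i)) ∧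
      c (Fin.last n) = f.coeff (k - 1) := by
  refine exists_congr fun f => and_congr_right fun _ => ⟨?_, fun h => ?_⟩
  · rintro rfl
    exact ⟨fun i => by simp [GRSextMap], by simp [GRSextMap]⟩
  · funext i
    refine Fin.lastCases ?_ (fun i => ?_) i
    · simp [GRSextMap, h.2]
    · simp [GRSextMap, h.1]

open Polynomial in
/-- A nonzero codeword of an extended GRS code vanishes in at most `k - 1` places. -/
theorem le_wt_of_mem_GRSext {K : Type*} [Field K] {n k : ℕ} {a v : Fin n → K}
    (ha : Function.Injective a) (hv : ∀ i, v i ≠ 0) (hk : k ≤ n + 1) {f : K[X]} (hf : f ∈ degreeLT K k)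
    (hf0 : f ≠ 0) : n + 1 - k + 1 ≤ wt (GRSextMap k a v f) := by
  classical
  rw [mem_degreeLT, ← natDegree_lt_iff_degree_lt hf0] at hf
  set Z : Finset (Fin n) := univ.filter fun i => f.eval (a i) = 0 with hZ
  have hZcard : #Z ≤ f.natDegree := by
    rw [← card_image_of_injective Z ha]
    refine (card_le_card ?_).trans ((Multiset.toFinset_card_le _).trans (card_roots' f))
    intro x hx
    obtain ⟨i, hi, rfl⟩ := mem_image.1 hx
    simp only [hZ, mem_filter] at hi
    simp [hf0, hi.2]
  have hwt : wt (GRSextMap k a v f) =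
      #(univ.filter fun i : Fin n => f.eval (a i) ≠ 0) + if f.coeff (k - 1) = 0 then 0 else 1 := by
    rw [wt, Nat.card_eq_fintype_card, Fintype.card_subtype, card_filter, Fin.sum_univ_castSucc,
      card_filter]
    simp [GRSextMap, hv]
  have hsum := card_filter_add_card_filter_not (s := (univ : Finset (Fin n)))
    fun i => f.eval (a i) = 0
  simp only [card_univ, Fintype.card_fin] at hsum
  rw [hwt]
  split_ifs with h
  · have : f.natDegree ≠ k - 1 := fun h' => hf0 (by
      rwa [← h', coeff_natDegree, leadingCoeff_eq_zero] at h)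
    change #Z + _ = _ at hsum
    simp only [ne_eq]
    omega
  · change #Z + _ = _ at hsum
    simp only [ne_eq]
    omega

open Polynomial in
/-- Extended GRS codes are MDS. -/
theorem isMDSCode_GRSext {K : Type*} [Field K] {n k : ℕ} {a v : Fin n → K}
    (ha : Function.Injective a) (hv : ∀ i, v i ≠ 0) (hk : k ≤ n + 1) :
    IsMDSCode (GRSext k a v) k := by
  have hinj : ∀ f ∈ degreeLT K k, GRSextMap k a v f = 0 → f = 0 := by
    intro f hf h
    by_contra hf0
    have := le_wt_of_mem_GRSext ha hv hk hf hf0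
    rw [h] at this
    simp [wt] at this
  refine ⟨?_, ?_⟩
  · have e : degreeLT K k ≃ₗ[K] GRSext k a v :=
      LinearEquiv.ofBijective ((GRSextMap k a v).submoduleMap _)
        ⟨(injective_iff_map_eq_zero _).2 fun f h => Subtype.ext
          (hinj f f.2 (congrArg Subtype.val h)), (GRSextMap k a v).submoduleMap_surjective _⟩
    rw [← e.finrank_eq, (degreeLTEquiv K k).finrank_eq]
    simp
  · rintro _ ⟨f, hf, rfl⟩ hc
    exact le_wt_of_mem_GRSext ha hv hk hf fun h => hc (by rw [h, map_zero])

open Polynomial in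
theorem GRSext_le_dualCode {K : Type*} [Field K] {n k : ℕ} {a v : Fin n → K}
    (ha : Function.Injective a) (hn : n + 1 = 2 * k)
    (hv : ∀ i, v i ^ 2 = -(delta a i)⁻¹) :
    GRSext k a v ≤ dualCode (GRSext k a v) := by
  intro x hx y hy
  obtain ⟨f, hf, hxf, hxl⟩ := mem_GRSext_iff.1 hx
  obtain ⟨g, hg, hyg, hyl⟩ := mem_GRSext_iff.1 hy
  have hk : 1 ≤ k := by omega
  have hnat : ∀ p ∈ degreeLT K k, p.natDegree ≤ k - 1 := fun p hp =>
    Nat.le_sub_one_of_lt (by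
      rcases eq_or_ne p 0 with rfl | h0
      · rwa [natDegree_zero]
      · exact (natDegree_lt_iff_degree_lt h0).2 (mem_degreeLT.1 hp))
  have hf' := hnat f hf
  have hg' := hnat g hg
  have hdeg : (f * g).degree < #(univ : Finset (Fin n)) := by
    refine degree_le_natDegree.trans_lt ?_
    rw [card_univ, Fintype.card_fin]
    exact_mod_cast natDegree_mul_le.trans_lt (by omega)
  have hcoeff := Lagrange.coeff_eq_sum (ha.injOn (s := ↑(univ : Finset (Fin n)))) hdeg
  rw [card_univ, Fintype.card_fin, show n - 1 = (k - 1) + (k - 1) by omega,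
    coeff_mul_add_eq_of_natDegree_le hf' hg'] at hcoeff
  rw [Fin.sum_univ_castSucc, hxl, hyl, hcoeff, ← sum_add_distrib]
  refine sum_eq_zero fun i _ => ?_
  have : v i * f.eval (a i) * (v i * g.eval (a i)) =
      v i ^ 2 * (f.eval (a i) * g.eval (a i)) := by ring
  rw [hxf, hyg, this, hv, eval_mul, div_eq_mul_inv, delta]
  ring

/-- If `-δ_S(x)` is a square for all `x` in a set `S` of size `2k - 1`, then there is an MDS
self-dual code of length `2k`. -/
theorem exists_isMDSCode_eq_dualCode {K : Type*} [Field K] [DecidableEq K] {n k : ℕ}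
    (S : Finset K) (hS : #S = n) (hn : n + 1 = 2 * k) (hsq : ∀ x ∈ S, IsSquare (-deltaSet S x)) :
    ∃ C : Submodule K (Fin (n + 1) → K), IsMDSCode C k ∧ C = dualCode C := by
  let e := (S.equivFinOfCardEq hS).symm
  let a : Fin n → K := fun i => e i
  have ha : Function.Injective a := Subtype.val_injective.comp e.injective
  have hdelta : ∀ i, delta a i = deltaSet S (a i) := by
    intro i
    refine prod_bij (fun j _ => a j) ?_ (fun _ _ _ _ h => ha h) ?_ (fun _ _ => rfl)
    · intro j hj
      exact mem_erase.2 ⟨ha.ne (mem_erase.1 hj).1, (e j).2⟩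
    · intro y hy
      obtain ⟨hy1, hy2⟩ := mem_erase.1 hy
      refine ⟨e.symm ⟨y, hy2⟩, mem_erase.2 ⟨?_, mem_univ _⟩, by simp [a]⟩
      rintro rfl
      simp [a] at hy1
  have hne : ∀ i, delta a i ≠ 0 := fun i => prod_ne_zero_iff.2 fun j hj =>
    sub_ne_zero.2 (ha.ne (mem_erase.1 hj).1.symm)
  have hex : ∀ i, ∃ w : K, w ^ 2 = -(delta a i)⁻¹ := by
    intro i
    obtain ⟨z, hz⟩ := hsq (a i) (e i).2
    refine ⟨z⁻¹, ?_⟩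
    rw [hdelta, ← inv_neg, hz, inv_pow, sq]
  choose v hv using hex
  have hv0 : ∀ i, v i ≠ 0 := by
    intro i h
    have := hv i
    rw [h] at this
    exact hne i (by simpa using this)
  have hMDS := isMDSCode_GRSext ha hv0 (k := k) (by omega)
  exact ⟨_, hMDS, eq_dualCode_of_le_of_finrank _ (GRSext_le_dualCode ha hn hv) hMDS.1 hn⟩

open Polynomial in
/-- A monic divisor of `X ^ q - X` is the nodal polynomial of its root set. -/
theorem exists_finset_deltaSet_eq_derivative {K : Type*} [Field K] [Fintype K] [DecidableEq K]
    {P : K[X]} (hP : P.Monic) (hdvd : P ∣ X ^ Fintype.card K - X) :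
    ∃ S : Finset K, #S = P.natDegree ∧
      ∀ x ∈ S, P.eval x = 0 ∧ deltaSet S x = P.derivative.eval x := by
  have hq0 := FiniteField.X_pow_card_sub_X_ne_zero K (Fintype.one_lt_card (α := K))
  have hqr := FiniteField.roots_X_pow_card_sub_X K
  have hqs : (X ^ Fintype.card K - X : K[X]).Splits := by
    rw [splits_iff_card_roots, hqr,
      FiniteField.X_pow_card_sub_X_natDegree_eq K Fintype.one_lt_card]
    rfl
  have hs := hqs.of_dvd hq0 hdvd
  have hnd : P.roots.Nodup :=
    Multiset.nodup_of_le (roots.le_of_dvd hq0 hdvd) (hqr ▸ univ.nodup)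
  have hnodal : P = Lagrange.nodal (P.roots.toFinset) id := by
    conv_lhs => rw [hs.eq_prod_roots_of_monic hP]
    rw [Lagrange.nodal, prod_eq_multiset_prod, Multiset.toFinset_val, hnd.dedup]
    rfl
  refine ⟨P.roots.toFinset, ?_, fun x hx => ⟨?_, ?_⟩⟩
  · rw [Multiset.toFinset_card_of_nodup hnd, hs.natDegree_eq_card_roots]
  · exact (mem_roots'.1 (Multiset.mem_toFinset.1 hx)).2
  · have h := Lagrange.eval_nodal_derivative_eval_node_eq (v := (id : K → K)) hx
    rw [← hnodal, Lagrange.eval_nodal] at h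
    exact h.symm

/-- The polynomial whose roots are the `m`-th roots of the elements of `U`. -/
noncomputable def rootPoly {K : Type*} [Field K] (m : ℕ) (U : Finset K) : Polynomial K :=
  ∏ u ∈ U, (Polynomial.X ^ m - Polynomial.C u)

section rootPoly

open Polynomial

theorem rootPoly_monic {K : Type*} [Field K] {m : ℕ} (hm : m ≠ 0) (U : Finset K) :
    (rootPoly m U).Monic :=
  monic_prod_of_monic _ _ fun u _ => monic_X_pow_sub_C u hm

theorem natDegree_rootPoly {K : Type*} [Field K] {m : ℕ} (hm : m ≠ 0) (U : Finset K) :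
    (rootPoly m U).natDegree = #U * m := by
  rw [rootPoly, natDegree_prod_of_monic _ _ fun u _ => monic_X_pow_sub_C u hm]
  simp

theorem eval_rootPoly {K : Type*} [Field K] (m : ℕ) (U : Finset K) (x : K) :
    (rootPoly m U).eval x = ∏ u ∈ U, (x ^ m - u) := by
  simp [rootPoly, eval_prod]

theorem exists_pow_eq_of_eval_rootPoly_eq_zero {K : Type*} [Field K] {m : ℕ} {U : Finset K}
    {x : K} (h : (rootPoly m U).eval x = 0) : x ^ m ∈ U := by
  rw [eval_rootPoly, prod_eq_zero_iff] at h
  obtain ⟨u, hu, h⟩ := h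
  rwa [sub_eq_zero.1 h]

theorem rootPoly_dvd {K : Type*} [Field K] {m k : ℕ} {U : Finset K} {e : K}
    (hU : ∀ u ∈ U, u ^ k = e) : rootPoly m U ∣ X ^ (m * k) - C e := by
  refine prod_dvd_of_coprime (fun u _ v _ huv => ?_) fun u hu => ?_
  · refine ⟨C (v - u)⁻¹, -C (v - u)⁻¹, ?_⟩
    have : (C (v - u)⁻¹ : K[X]) * (C v - C u) = 1 := by
      rw [← C_sub, ← C_mul, inv_mul_cancel₀ (sub_ne_zero.2 huv.symm), C_1]
    linear_combination this
  · rw [pow_mul, ← hU u hu, C_pow]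
    exact sub_dvd_pow_sub_pow _ _ _

theorem mul_eval_derivative_rootPoly {K : Type*} [Field K] [DecidableEq K] {m : ℕ} (hm : m ≠ 0)
    {U : Finset K} {x : K} (hx : x ^ m ∈ U) :
    x * (rootPoly m U).derivative.eval x = m * x ^ m * ∏ v ∈ U.erase (x ^ m), (x ^ m - v) := by
  have hx' : x * x ^ (m - 1) = x ^ m := mul_pow_sub_one hm x
  rw [rootPoly, ← mul_prod_erase U _ hx]
  simp only [derivative_mul, derivative_sub, derivative_X_pow, derivative_C, eval_add, eval_mul,
    eval_sub, eval_pow, eval_X, eval_C, eval_prod, sub_self, zero_mul, add_zero, sub_zero]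
  rw [← hx']
  ring

end rootPoly

open Polynomial in
/-- If the products below are squares, the `m`-th roots of `U`, the `l`-th roots of `W` and `0`
form a set `S` of size `#U * m + #W * l + 1` on which `-δ_S` takes square values. -/
theorem exists_finset_isSquare_neg_deltaSet {K : Type*} [Field K] [Fintype K] [DecidableEq K]
    {m l h a b : ℕ} {U W : Finset K} (hm : m ≠ 0) (hl : l ≠ 0) (ham : m * a = h) (hbl : l * b = h)
    (hcard : Fintype.card K = 2 * h + 1) (hU : ∀ u ∈ U, u ^ a = 1)
    (hW : ∀ w ∈ W, w ^ b = -1) (hneg : IsSquare (-1 : K))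
    (hmsq : IsSquare (m : K)) (hlsq : IsSquare (l : K))
    (hUsq : ∀ u ∈ U, IsSquare u) (hWsq : ∀ w ∈ W, IsSquare w)
    (hUU : ∀ u ∈ U, ∀ v ∈ U, IsSquare (u - v)) (hWW : ∀ u ∈ W, ∀ v ∈ W, IsSquare (u - v))
    (hUW : ∀ x, x ^ m ∈ U → IsSquare (∏ w ∈ W, (x ^ l - w)))
    (hWU : ∀ x, x ^ l ∈ W → IsSquare (∏ u ∈ U, (x ^ m - u))) :
    ∃ S : Finset K, #S = #U * m + #W * l + 1 ∧ ∀ x ∈ S, IsSquare (-deltaSet S x) := by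
  have hh : h ≠ 0 := by
    rintro rfl
    exact Fintype.one_lt_card.ne' hcard
  have hdU : rootPoly m U ∣ X ^ h - C 1 := ham ▸ rootPoly_dvd hU
  have hdW : rootPoly l W ∣ X ^ h - C (-1) := hbl ▸ rootPoly_dvd hW
  have hdvd : X * (rootPoly m U * rootPoly l W) ∣ X ^ Fintype.card K - X := by
    have : (X ^ Fintype.card K - X : K[X]) = X * ((X ^ h - C 1) * (X ^ h - C (-1))) := by
      rw [hcard, C_neg, C_1]
      ring
    rw [this]
    exact mul_dvd_mul_left _ (mul_dvd_mul hdU hdW)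
  have hmon : (X * (rootPoly m U * rootPoly l W)).Monic :=
    monic_X.mul ((rootPoly_monic hm U).mul (rootPoly_monic hl W))
  obtain ⟨S, hS, hSδ⟩ := exists_finset_deltaSet_eq_derivative hmon hdvd
  refine ⟨S, ?_, fun x hx => ?_⟩
  · rw [hS, Monic.natDegree_mul monic_X ((rootPoly_monic hm U).mul (rootPoly_monic hl W)),
      Monic.natDegree_mul (rootPoly_monic hm U) (rootPoly_monic hl W), natDegree_rootPoly hm,
      natDegree_rootPoly hl, natDegree_X, add_comm]
  obtain ⟨h0, hδ⟩ := hSδ x hx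
  rw [hδ, neg_eq_neg_one_mul]
  refine hneg.mul ?_
  have hder : (X * (rootPoly m U * rootPoly l W)).derivative.eval x =
      (rootPoly m U).eval x * (rootPoly l W).eval x +
      (x * (rootPoly m U).derivative.eval x) * (rootPoly l W).eval x +
      (x * (rootPoly l W).derivative.eval x) * (rootPoly m U).eval x := by
    simp only [derivative_mul, derivative_X, eval_add, eval_mul, eval_X, eval_one]
    ring
  have hprod : ∀ (V : Finset K) (f : K → K), (∀ v ∈ V, IsSquare (f v)) →
      IsSquare (∏ v ∈ V, f v) := fun V f hf =>
    prod_induction f IsSquare (fun _ _ => IsSquare.mul) IsSquare.one hf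
  rw [hder]
  simp only [eval_mul, eval_X, mul_eq_zero] at h0
  rcases h0 with rfl | h0 | h0
  · simp only [zero_mul, add_zero, eval_rootPoly, zero_pow hm, zero_pow hl, zero_sub]
    refine (hprod _ _ fun v hv => ?_).mul (hprod _ _ fun v hv => ?_)
    · rw [neg_eq_neg_one_mul]
      exact hneg.mul (hUsq v hv)
    · rw [neg_eq_neg_one_mul]
      exact hneg.mul (hWsq v hv)
  · have hxU := exists_pow_eq_of_eval_rootPoly_eq_zero h0
    rw [h0, mul_eval_derivative_rootPoly hm hxU, zero_mul, zero_add, mul_zero, add_zero,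
      eval_rootPoly]
    exact ((hmsq.mul (hUsq _ hxU)).mul
      (hprod _ _ fun v hv => hUU _ hxU v (mem_of_mem_erase hv))).mul (hUW x hxU)
  · have hxW := exists_pow_eq_of_eval_rootPoly_eq_zero h0
    rw [h0, mul_eval_derivative_rootPoly hl hxW, mul_zero, mul_zero, zero_add, zero_add,
      eval_rootPoly]
    exact ((hlsq.mul (hWsq _ hxW)).mul
      (hprod _ _ fun v hv => hWW _ hxW v (mem_of_mem_erase hv))).mul (hWU x hxW)

section ArithmeticInQuadraticExtension

variable {K : Type*} [Field K] [Fintype K] {r e : ℕ}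

theorem exists_charP_of_card_eq_sq (hK : Fintype.card K = r ^ 2) (hpp : IsPrimePow r) :
    ∃ p k : ℕ, p.Prime ∧ CharP K p ∧ r = p ^ k := by
  obtain ⟨p, k, hp, -, rfl⟩ := (isPrimePow_nat_iff _).1 hpp
  have := Fact.mk hp
  exact ⟨p, k, hp, charP_of_card_eq_prime_pow (f := k * 2) (by rw [hK, pow_mul]), rfl⟩

theorem sub_pow_of_card_eq_sq (hK : Fintype.card K = r ^ 2) (hpp : IsPrimePow r) (x y : K) :
    (x - y) ^ r = x ^ r - y ^ r := by
  obtain ⟨p, k, hp, hc, rfl⟩ := exists_charP_of_card_eq_sq hK hpp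
  have := Fact.mk hp
  exact sub_pow_char_pow x y k

theorem natCast_pow_of_card_eq_sq (hK : Fintype.card K = r ^ 2) (hpp : IsPrimePow r) (n : ℕ) :
    (n : K) ^ r = n := by
  obtain ⟨p, k, hp, hc, rfl⟩ := exists_charP_of_card_eq_sq hK hpp
  have := Fact.mk hp
  rw [← iterateFrobenius_def, map_natCast]

theorem isSquare_iff_pow_eq_one (hK : Fintype.card K = r ^ 2) (he : r + 1 = 4 * e) {x : K}
    (hx : x ≠ 0) : IsSquare x ↔ x ^ ((r - 1) * (2 * e)) = 1 := by
  have hr : (r ^ 2) = 2 * ((r - 1) * (2 * e)) + 1 := by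
    obtain ⟨r, rfl⟩ : ∃ n, r = n + 1 := ⟨r - 1, by
      rcases r with _ | r
      · omega
      · rfl⟩
    have : 2 * (r * (2 * e)) = r * (r + 1 + 1) := by rw [he]; ring
    rw [Nat.add_sub_cancel, this]
    ring
  have hchar : ringChar K ≠ 2 := by
    intro h
    have := FiniteField.even_card_of_char_two h
    omega
  rw [FiniteField.isSquare_iff hchar hx, hK, hr]
  congr! 2
  omega

/-- Elements of the subfield of order `r` are squares in the field of order `r ^ 2`. -/
theorem isSquare_of_pow_eq_self (hK : Fintype.card K = r ^ 2) (he : r + 1 = 4 * e) {x : K}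
    (hx : x ^ r = x) : IsSquare x := by
  rcases eq_or_ne x 0 with rfl | h0
  · exact IsSquare.zero
  rw [isSquare_iff_pow_eq_one hK he h0, pow_mul]
  have : x ^ (r - 1) = 1 := mul_left_cancel₀ h0 (by
    rw [mul_pow_sub_one (by omega), hx, mul_one])
  rw [this, one_pow]

/-- The quadratic character of the difference of two elements of norm one. -/
theorem sub_pow_half_of_norm_one (hK : Fintype.card K = r ^ 2) (hpp : IsPrimePow r)
    (he : r + 1 = 4 * e) {u v : K} (hu : u ^ (r + 1) = 1) (hv : v ^ (r + 1) = 1) (huv : u ≠ v) :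
    (u - v) ^ ((r - 1) * (2 * e)) = u ^ (2 * e) * v ^ (2 * e) := by
  have h1 : (u - v) ^ (r - 1) * (u * v) = -1 := by
    refine mul_left_cancel₀ (sub_ne_zero.2 huv) ?_
    rw [← mul_assoc, mul_pow_sub_one (by omega), sub_pow_of_card_eq_sq hK hpp]
    rw [pow_succ] at hu hv
    linear_combination v * hu - u * hv
  have h2 : ((u - v) ^ (r - 1)) ^ (2 * e) * (u * v) ^ (2 * e) = 1 := by
    rw [← mul_pow, h1, pow_mul]
    simp
  have h3 : (u * v) ^ (2 * e) * (u * v) ^ (2 * e) = 1 := by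
    rw [← pow_add, show 2 * e + 2 * e = r + 1 by omega, mul_pow, hu, hv, one_mul]
  rw [pow_mul, ← mul_pow]
  linear_combination (u * v) ^ (2 * e) * h2 - ((u - v) ^ (r - 1)) ^ (2 * e) * h3

end ArithmeticInQuadraticExtension

theorem exists_orderOf_eq_of_dvd_card_sub_one {K : Type*} [Field K] [Fintype K] {d : ℕ}
    (hd : d ∣ Fintype.card K - 1) : ∃ z : K, orderOf z = d := by
  classical
  obtain ⟨g, hg⟩ := IsCyclic.exists_ofOrder_eq_natCard (α := Kˣ)
  rw [Nat.card_eq_fintype_card, Fintype.card_units] at hg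
  obtain ⟨n, hn⟩ := hd
  have hpos : 0 < Fintype.card K - 1 := Nat.sub_pos_of_lt Fintype.one_lt_card
  have hn0 : n ≠ 0 := by
    rintro rfl
    omega
  refine ⟨(g ^ n : Kˣ), ?_⟩
  rw [orderOf_units, orderOf_pow_of_dvd hn0 (by rw [hg, hn]; exact dvd_mul_left _ _), hg, hn,
    Nat.mul_div_cancel _ (Nat.pos_of_ne_zero hn0)]

/-- The points of the code: with `a = 2 * g * A`, `b = 2 * g * B`, take the `m`-th roots of the
first `s` elements of the group of order `A`, the `l`-th roots of the negatives of the first `t`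
elements of the group of order `B`, and `0`. -/
theorem exists_finset_card_eq_isSquare_neg_deltaSet {K : Type*} [Field K] [Fintype K]
    [DecidableEq K] {r e g A B m l c d s t : ℕ} (hK : Fintype.card K = r ^ 2)
    (hpp : IsPrimePow r) (he : r + 1 = 4 * e) (hm : m * (g * A) = (r - 1) * (2 * e))
    (hl : l * (g * B) = (r - 1) * (2 * e)) (hAB : A.Coprime B) (hgB : Odd (g * B))
    (hc : B * (2 * e) = A * c) (hd : A * (2 * e - 1) = B * d) (hs : s ≤ A) (ht : t ≤ B)
    (hcs : Even (c * s)) :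
    ∃ S : Finset K, #S = s * m + t * l + 1 ∧ ∀ x ∈ S, IsSquare (-deltaSet S x) := by
  have he0 : 0 < e := by omega
  have hr1 : r - 1 = 2 * (2 * e - 1) := by omega
  have hh : (r - 1) * (2 * e) ≠ 0 := by
    refine mul_ne_zero ?_ ?_ <;> omega
  have hm0 : m ≠ 0 := left_ne_zero_of_mul (hm ▸ hh)
  have hl0 : l ≠ 0 := left_ne_zero_of_mul (hl ▸ hh)
  have hgA0 : g * A ≠ 0 := right_ne_zero_of_mul (hm ▸ hh)
  have hgB0 : g * B ≠ 0 := right_ne_zero_of_mul (hl ▸ hh)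
  have hg0 : g ≠ 0 := left_ne_zero_of_mul hgA0
  have hA0 : A ≠ 0 := right_ne_zero_of_mul hgA0
  have hB0 : B ≠ 0 := right_ne_zero_of_mul hgB0
  have hcard : Fintype.card K = 2 * ((r - 1) * (2 * e)) + 1 := by
    obtain ⟨n, hn⟩ : ∃ n, r = n + 1 := ⟨r - 1, by omega⟩
    subst hn
    have : 2 * (n * (2 * e)) = n * (n + 1 + 1) := by rw [he]; ring
    rw [hK, Nat.add_sub_cancel, this]
    ring
  have hAe : A ∣ 2 * e := hAB.dvd_of_dvd_mul_left ⟨c, hc⟩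
  have hBe : B ∣ 2 * e - 1 := hAB.symm.dvd_of_dvd_mul_left ⟨d, hd⟩
  have hBc : B ∣ c := hAB.symm.dvd_of_dvd_mul_left ⟨_, hc.symm⟩
  have hAd : A ∣ d := hAB.dvd_of_dvd_mul_left ⟨_, hd.symm⟩
  have hmd : l * (2 * e - 1) = m * d := by
    refine Nat.eq_of_mul_eq_mul_left (Nat.pos_of_ne_zero hgB0) ?_
    calc g * B * (l * (2 * e - 1)) = l * (g * B) * (2 * e - 1) := by ring
      _ = m * g * (A * (2 * e - 1)) := by rw [hl, ← hm]; ring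
      _ = _ := by rw [hd]; ring
  have hlc : m * (2 * e) = l * c := by
    refine Nat.eq_of_mul_eq_mul_left (Nat.pos_of_ne_zero hgB0) ?_
    calc g * B * (m * (2 * e)) = m * g * (B * (2 * e)) := by ring
      _ = m * (g * A) * c := by rw [hc]; ring
      _ = _ := by rw [hm, ← hl]; ring
  have hBodd : Odd B := (Nat.odd_mul.1 hgB).2
  have hrodd : Odd r := by
    rw [Nat.odd_iff]
    omega
  obtain ⟨ζ, hζ⟩ := exists_orderOf_eq_of_dvd_card_sub_one (K := K) (d := A)
    ⟨2 * (m * g), by rw [hcard, Nat.add_sub_cancel, ← hm]; ring⟩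
  obtain ⟨ω, hω⟩ := exists_orderOf_eq_of_dvd_card_sub_one (K := K) (d := B)
    ⟨2 * (l * g), by rw [hcard, Nat.add_sub_cancel, ← hl]; ring⟩
  set U : Finset K := (range s).image (ζ ^ ·) with hUdef
  set W : Finset K := (range t).image (-ω ^ ·) with hWdef
  have hUcard : #U = s := by
    rw [hUdef, card_image_of_injOn, card_range]
    intro i hi j hj hij
    simp only [coe_range, Set.mem_Iio] at hi hj
    exact pow_injOn_Iio_orderOf (by simp; omega) (by simp; omega) hij
  have hWcard : #W = t := by
    rw [hWdef, card_image_of_injOn, card_range]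
    intro i hi j hj hij
    simp only [coe_range, Set.mem_Iio] at hi hj
    exact pow_injOn_Iio_orderOf (by simp; omega) (by simp; omega) (neg_injective hij)
  have hUpow : ∀ u ∈ U, ∀ n, A ∣ n → u ^ n = 1 := by
    rintro u hu n ⟨k, rfl⟩
    obtain ⟨i, -, rfl⟩ := mem_image.1 hu
    rw [← pow_mul, show i * (A * k) = A * (i * k) by ring, pow_mul, ← hζ, pow_orderOf_eq_one,
      one_pow]
  have hWpow : ∀ w ∈ W, ∀ n, B ∣ n → w ^ n = (-1) ^ n := by
    rintro w hw n ⟨k, rfl⟩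
    obtain ⟨i, -, rfl⟩ := mem_image.1 hw
    rw [neg_pow, ← pow_mul, show i * (B * k) = B * (i * k) by ring, pow_mul ω, ← hω,
      pow_orderOf_eq_one, one_pow, mul_one]
  have hpow_self : ∀ x : K, x ^ (r - 1) = 1 → x ^ r = x := fun x hx => by
    rw [← mul_pow_sub_one (by omega : r ≠ 0), hx, mul_one]
  have hWself : ∀ w ∈ W, w ^ r = w := fun w hw => hpow_self w (by
    rw [hWpow w hw _ (hr1 ▸ hBe.mul_left 2), hr1, pow_mul]
    simp)
  have hsub : ∀ x y : K, x ^ r = x → y ^ r = y → IsSquare (x - y) := fun x y hx hy =>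
    isSquare_of_pow_eq_self hK he (by rw [sub_pow_of_card_eq_sq hK hpp, hx, hy])
  have hr2e : r + 1 = 2 * e * 2 := by omega
  rw [← hUcard, ← hWcard]
  refine exists_finset_isSquare_neg_deltaSet hm0 hl0 hm hl hcard
    (fun u hu => hUpow u hu _ (dvd_mul_left _ _))
    (fun w hw => (hWpow w hw _ (dvd_mul_left _ _)).trans hgB.neg_one_pow)
    (isSquare_of_pow_eq_self hK he hrodd.neg_one_pow)
    (isSquare_of_pow_eq_self hK he (natCast_pow_of_card_eq_sq hK hpp m))
    (isSquare_of_pow_eq_self hK he (natCast_pow_of_card_eq_sq hK hpp l))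
    (fun u hu => ?_) (fun w hw => isSquare_of_pow_eq_self hK he (hWself w hw))
    (fun u hu v hv => ?_) (fun u hu v hv => hsub u v (hWself u hu) (hWself v hv))
    (fun x hx => ?_) (fun x hx => ?_)
  · have hu0 : u ≠ 0 := by
      rintro rfl
      simpa [hA0] using hUpow 0 hu A dvd_rfl
    rw [isSquare_iff_pow_eq_one hK he hu0]
    exact hUpow u hu _ (hAe.mul_left _)
  · rcases eq_or_ne u v with rfl | huv
    · simp
    have hdvd : A ∣ r + 1 := hr2e ▸ hAe.mul_right 2
    rw [isSquare_iff_pow_eq_one hK he (sub_ne_zero.2 huv),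
      sub_pow_half_of_norm_one hK hpp he (hUpow u hu _ hdvd) (hUpow v hv _ hdvd) huv,
      hUpow u hu _ hAe, hUpow v hv _ hAe, one_mul]
  · have hxl : (x ^ l) ^ r = x ^ l := hpow_self _ (by
      rw [hr1, mul_comm 2, pow_mul, ← pow_mul x, hmd, pow_mul, hUpow _ hx _ hAd, one_pow])
    exact prod_induction _ IsSquare (fun _ _ => IsSquare.mul) IsSquare.one
      fun w hw => hsub _ _ hxl (hWself w hw)
  · have hxm : (x ^ m) ^ (2 * e) = (-1) ^ c := by
      rw [← pow_mul, hlc, pow_mul, hWpow _ hx _ hBc]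
    by_cases hmem : x ^ m ∈ U
    · rw [prod_eq_zero hmem (sub_self _)]
      exact IsSquare.zero
    have hdvd : A ∣ r + 1 := hr2e ▸ hAe.mul_right 2
    have hne : ∀ u ∈ U, x ^ m ≠ u := fun u hu h => hmem (h ▸ hu)
    have hnorm : (x ^ m) ^ (r + 1) = 1 := by
      rw [hr2e, pow_mul, hxm, ← pow_mul, mul_comm, pow_mul]
      simp
    rw [isSquare_iff_pow_eq_one hK he (prod_ne_zero_iff.2 fun u hu => sub_ne_zero.2 (hne u hu)),
      ← prod_pow, prod_congr rfl fun u hu => by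
        rw [sub_pow_half_of_norm_one hK hpp he hnorm (hUpow u hu _ hdvd) (hne u hu), hxm,
          hUpow u hu _ hAe, mul_one], prod_const, ← pow_mul, hUcard]
    exact hcs.neg_one_pow

/-- Theorem 2(ii): `q = r²`, `r ≡ 3 (mod 4)`, `a, b` even divisors of `q-1`, `b ≡ 2 (mod 4)`,
`2a ∣ b(r+1)`, `2b ∣ a(r-1)`, `1 ≤ s ≤ a/gcd(a,b)`, `1 ≤ t ≤ b/gcd(a,b)`, and
`(r+1)bs²/(2a)` even: there exists a `q`-ary MDS Euclidean self-dual code of length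
`n + 2`, where `n = s(q-1)/a + t(q-1)/b`. -/
theorem stmt15 {F : Type*} [Field F] [Fintype F] {q r : ℕ} (hq : Fintype.card F = q)
    (hq2 : q = r ^ 2) (hpp : IsPrimePow r) (hr4 : r % 4 = 3)
    {a b : ℕ} (hae : Even a) (hbe : Even b) (ha : a ∣ q - 1) (hb : b ∣ q - 1)
    (hb4 : b % 4 = 2) (hab : 2 * a ∣ b * (r + 1)) (hba : 2 * b ∣ a * (r - 1))
    {s t : ℕ} (hs1 : 1 ≤ s) (hs2 : s ≤ a / Nat.gcd a b)
    (ht1 : 1 ≤ t) (ht2 : t ≤ b / Nat.gcd a b)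
    (heven : Even ((r + 1) * b * s ^ 2 / (2 * a))) :
    ∃ C : Submodule F (Fin (s * ((q - 1) / a) + t * ((q - 1) / b) + 2) → F),
      IsMDSCode C ((s * ((q - 1) / a) + t * ((q - 1) / b) + 2) / 2) ∧ C = dualCode C := by
  classical
  subst hq2
  obtain ⟨e, he⟩ : ∃ e, r + 1 = 4 * e := ⟨(r + 1) / 4, by omega⟩
  have he0 : 0 < e := by omega
  have hq1 : r ^ 2 - 1 = 2 * ((r - 1) * (2 * e)) := by
    have : r ^ 2 - 1 = (r + 1) * (r - 1) := by simpa using Nat.sq_sub_sq r 1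
    rw [this, he]
    ring
  have hq0 : r ^ 2 - 1 ≠ 0 := by
    rw [hq1]
    refine mul_ne_zero two_ne_zero (mul_ne_zero ?_ ?_) <;> omega
  obtain ⟨m, hm⟩ := ha
  obtain ⟨l, hl⟩ := hb
  have ha0 : 0 < a := Nat.pos_of_ne_zero (left_ne_zero_of_mul (hm ▸ hq0))
  have hb0 : 0 < b := by omega
  have hmdiv : (r ^ 2 - 1) / a = m := by rw [hm, Nat.mul_div_cancel_left _ ha0]
  have hldiv : (r ^ 2 - 1) / b = l := by rw [hl, Nat.mul_div_cancel_left _ hb0]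
  rw [hmdiv, hldiv]
  obtain ⟨c, hc⟩ := hab
  obtain ⟨d, hd⟩ := hba
  obtain ⟨g, hg⟩ := Nat.dvd_gcd hae.two_dvd hbe.two_dvd
  have hgcd0 : 0 < Nat.gcd a b := Nat.gcd_pos_of_pos_left _ ha0
  obtain ⟨A, B, hAB, hA, hB⟩ := Nat.exists_coprime a b
  rw [hg] at hs2 ht2 hgcd0 hA hB
  have hAdiv : a / (2 * g) = A := by
    conv_lhs => rw [hA]
    exact Nat.mul_div_cancel _ hgcd0
  have hBdiv : b / (2 * g) = B := by
    conv_lhs => rw [hB]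
    exact Nat.mul_div_cancel _ hgcd0
  rw [hAdiv] at hs2
  rw [hBdiv] at ht2
  have hg0 : 0 < g := by omega
  have hmgA : m * (g * A) = (r - 1) * (2 * e) := by
    refine Nat.eq_of_mul_eq_mul_left two_pos ?_
    rw [← hq1, hm, hA]
    ring
  have hlgB : l * (g * B) = (r - 1) * (2 * e) := by
    refine Nat.eq_of_mul_eq_mul_left two_pos ?_
    rw [← hq1, hl, hB]
    ring
  have hgB : Odd (g * B) := by
    have : b = 2 * (g * B) := by rw [hB]; ring
    rw [Nat.odd_iff]
    omega
  have hc' : B * (2 * e) = A * c := by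
    refine Nat.eq_of_mul_eq_mul_left (show 0 < 4 * g by omega) ?_
    rw [hA, hB, he] at hc
    linarith
  have hd' : A * (2 * e - 1) = B * d := by
    refine Nat.eq_of_mul_eq_mul_left (show 0 < 4 * g by omega) ?_
    rw [hA, hB, show r - 1 = 2 * (2 * e - 1) by omega] at hd
    linarith
  have hcs : Even (c * s) := by
    have : (r + 1) * b * s ^ 2 = 2 * a * (c * s ^ 2) := by
      rw [mul_comm (r + 1), hc]
      ring
    rw [this, Nat.mul_div_cancel_left _ (by omega)] at heven
    simpa [Nat.even_mul, Nat.even_pow] using heven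
  have hleven : Even l := by
    have : Even (l * (g * B)) := hlgB ▸ (even_two_mul e).mul_left _
    exact (Nat.even_mul.1 this).resolve_right (Nat.not_even_iff_odd.2 hgB)
  have hmeven : Even m := by
    have : Even (m * (g * B)) := by
      refine ⟨(2 * e - 1) * c, ?_⟩
      refine Nat.eq_of_mul_eq_mul_left
        (Nat.pos_of_ne_zero (left_ne_zero_of_mul (hA ▸ ha0).ne' : A ≠ 0)) ?_
      calc A * (m * (g * B)) = m * (g * A) * B := by ring
        _ = (r - 1) * (B * (2 * e)) := by rw [hmgA]; ring
        _ = _ := by rw [hc', show r - 1 = 2 * (2 * e - 1) by omega]; ring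
    exact (Nat.even_mul.1 this).resolve_right (Nat.not_even_iff_odd.2 hgB)
  obtain ⟨S, hS, hSsq⟩ := exists_finset_card_eq_isSquare_neg_deltaSet hq hpp he hmgA hlgB hAB hgB
    hc' hd' hs2 ht2 hcs
  refine exists_isMDSCode_eq_dualCode S hS ?_ hSsq
  have : Even (s * m + t * l) := (hmeven.mul_left s).add (hleven.mul_left t)
  rw [Nat.even_iff] at this
  omega
end

section
/- Let q = r^2 with r ≡ 1 (mod 4), and let a, b be even divisors of q-1 with a ≡ 2 (mod 4), 2a | b(r+1), 2b | a(r-1). For odd s with 1 ≤ s ≤ a/gcd(a,b) and any 1 ≤ t ≤ b/gcd(a,b), setting n = s(q-1)/a + t(q-1)/b, there exists a q-ary MDS Euclidean almost self-dual code of length n+1, i.e., an [n+1, n/2] MDS code C with C ⊆ C^⊥ and dim C^⊥ = dim C + 1. -/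
open Finset

variable {F : Type*} [Field F]

open Polynomial in
theorem GRSext_isMDSCode {n k : ℕ} (hk : 1 ≤ k) (hkn : k ≤ n) {x w : Fin n → F}
    (hx : Function.Injective x) (hw : ∀ i, w i ≠ 0) : IsMDSCode (GRSext k x w) k := by
  classical
  have weight : ∀ f : F[X], f ∈ degreeLT F k → f ≠ 0 →
      n + 1 - k + 1 ≤ wt (GRSextMap k x w f) := by
    intro f hf hf0
    have hdeg : f.natDegree < k := (natDegree_lt_iff_degree_lt hf0).2 (mem_degreeLT.1 hf)
    set c := GRSextMap k x w f with hc
    have hZ : #{i | c i = 0} ≤ k - 1 := by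
      have hA : #{i : Fin n | c i.castSucc = 0} ≤ f.natDegree := by
        refine le_trans ?_ (card_roots' f)
        rw [← card_image_of_injective _ hx]
        refine (card_le_card ?_).trans (Multiset.toFinset_card_le _)
        intro y hy
        obtain ⟨i, hi, rfl⟩ := mem_image.1 hy
        have := (mem_filter.1 hi).2
        simp only [hc, GRSextMap, LinearMap.coe_mk, AddHom.coe_mk, Fin.val_castSucc, i.isLt,
          dite_true, mul_eq_zero, hw, false_or] at this
        simpa [hf0] using this
      have hlast : c (Fin.last n) = f.coeff (k - 1) := by simp [hc, GRSextMap]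
      rw [card_filter, Fin.sum_univ_castSucc, ← card_filter, hlast]
      split_ifs with h
      · have : f.natDegree ≠ k - 1 := by
          intro he
          rw [← he] at h
          exact hf0 (leadingCoeff_eq_zero.1 h)
        omega
      · omega
    have hwt : wt c = #{i | c i ≠ 0} := by
      rw [wt, Nat.card_eq_fintype_card, Fintype.card_subtype]
    have hsum := card_filter_add_card_filter_not (s := univ) (fun i => c i = 0)
    rw [card_univ, Fintype.card_fin] at hsum
    have : #{i | c i ≠ 0} = #{i | ¬ c i = 0} := rfl
    omega
  have hker : ∀ f ∈ degreeLT F k, GRSextMap k x w f = 0 → f = 0 := by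
    intro f hf h
    by_contra hf0
    have := weight f hf hf0
    simp [h, wt] at this
  constructor
  · rw [GRSext, ← LinearMap.range_domRestrict, LinearMap.finrank_range_of_inj,
      (degreeLTEquiv F k).finrank_eq, Module.finrank_fin_fun]
    rw [← LinearMap.ker_eq_bot, LinearMap.ker_eq_bot']
    exact fun f h => Subtype.ext (hker f f.2 h)
  · rintro c ⟨f, hf, rfl⟩ hc
    exact weight f hf (by rintro rfl; simp at hc)

open Polynomial in
theorem GRSext_le_dualCode_s17 {k : ℕ} (hk : 1 ≤ k) {n : ℕ} (hn : n = 2 * k) {x w : Fin n → F}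
    (hx : Function.Injective x) (hw : ∀ i, w i ^ 2 * delta x i = -x i) :
    GRSext k x w ≤ dualCode (GRSext k x w) := by
  rintro _ ⟨f, hf, rfl⟩ _ ⟨g, hg, rfl⟩
  have hf' : f.natDegree ≤ k - 1 := by
    rcases eq_or_ne f 0 with rfl | h0
    · simp
    · have := (natDegree_lt_iff_degree_lt h0).2 (mem_degreeLT.1 hf)
      omega
  have hg' : g.natDegree ≤ k - 1 := by
    rcases eq_or_ne g 0 with rfl | h0
    · simp
    · have := (natDegree_lt_iff_degree_lt h0).2 (mem_degreeLT.1 hg)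
      omega
  have hdelta : ∀ i, delta x i ≠ 0 := fun i =>
    prod_ne_zero_iff.2 fun j hj => sub_ne_zero.2 fun h => (mem_erase.1 hj).1 (hx h).symm
  have hnat : (X * (f * g)).natDegree < n := by
    have h1 := natDegree_mul_le (p := X) (q := f * g)
    have h2 := natDegree_mul_le (p := f) (q := g)
    have h3 : (X : F[X]).natDegree ≤ 1 := natDegree_X_le
    omega
  have key := Lagrange.coeff_eq_sum (s := univ) (v := x) hx.injOn (P := X * (f * g))
    (by rw [card_univ, Fintype.card_fin]
        exact (degree_le_natDegree).trans_lt (by exact_mod_cast hnat))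
  rw [card_univ, Fintype.card_fin, show n - 1 = ((k - 1) + (k - 1)) + 1 by omega, coeff_X_mul,
    coeff_mul_add_eq_of_natDegree_le hf' hg'] at key
  rw [Fin.sum_univ_castSucc]
  simp only [GRSextMap, LinearMap.coe_mk, AddHom.coe_mk, Fin.val_castSucc, Fin.is_lt, dite_true,
    Fin.val_last, lt_irrefl, dite_false, key, ← sum_add_distrib]
  refine sum_eq_zero fun i _ => ?_
  have hi := hdelta i
  change _ + _ / delta x i = 0
  simp only [eval_mul, eval_X]
  field_simp
  linear_combination eval (x i) f * eval (x i) g * hw i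

theorem finrank_add_finrank_dualCode {n : ℕ} (C : Submodule F (Fin n → F)) :
    Module.finrank F C + Module.finrank F (dualCode C) = n := by
  have h : dualCode C = C.dualAnnihilator.map (dotProductEquiv F (Fin n)).symm.toLinearMap := by
    ext v
    simp [Submodule.map_equiv_eq_comap_symm, dualCode, Submodule.mem_dualAnnihilator, dotProduct]
  rw [h, LinearEquiv.finrank_map_eq,
    Subspace.finrank_add_finrank_dualAnnihilator_eq, Module.finrank_fin_fun]

open Polynomial in
theorem exists_injective_nodal_eq [Fintype F] {P : F[X]} {n : ℕ} (hP : P.Monic)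
    (hdeg : P.natDegree = n) (hdvd : P ∣ X ^ Fintype.card F - X) :
    ∃ x : Fin n → F, Function.Injective x ∧ Lagrange.nodal univ x = P := by
  classical
  have hne : (X ^ Fintype.card F - X : F[X]) ≠ 0 :=
    FiniteField.X_pow_card_sub_X_ne_zero F Fintype.one_lt_card
  have hsplit : (X ^ Fintype.card F - X : F[X]).Splits := by
    rw [splits_iff_card_roots, FiniteField.roots_X_pow_card_sub_X,
      FiniteField.X_pow_card_sub_X_natDegree_eq F Fintype.one_lt_card]
    rfl
  have hnodup : P.roots.Nodup := by
    refine Multiset.nodup_of_le (Polynomial.roots.le_of_dvd hne hdvd) ?_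
    rw [FiniteField.roots_X_pow_card_sub_X]
    exact univ.nodup
  have hcard : P.roots.card = P.natDegree :=
    (hsplit.of_dvd hne hdvd).natDegree_eq_card_roots.symm
  let A : Finset F := ⟨P.roots, hnodup⟩
  have hA : A.card = n := hcard.trans hdeg
  let e := A.equivFinOfCardEq hA
  refine ⟨fun i => e.symm i, Subtype.val_injective.comp e.symm.injective, ?_⟩
  rw [Lagrange.nodal_eq, ← prod_multiset_X_sub_C_of_monic_of_roots_card_eq hP hcard]
  rw [Equiv.prod_comp e.symm (fun y : A => X - C (y : F)),
    univ_eq_attach, prod_attach A (fun y => X - C y)]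
  rfl

open Polynomial in
theorem prod_X_pow_sub_C_dvd {ι : Type*} {I : Finset ι} {c : ι → F} {N d : ℕ} {e : F}
    (hc : Set.InjOn c I) (he : ∀ i ∈ I, c i ^ d = e) :
    ∏ i ∈ I, (X ^ N - C (c i)) ∣ X ^ (N * d) - C e := by
  refine prod_dvd_of_coprime ?_ ?_
  · intro i hi j hj hij
    have hne : c j - c i ≠ 0 := sub_ne_zero.2 fun h => hij (hc hi hj h.symm)
    refine ⟨C (c j - c i)⁻¹, -C (c j - c i)⁻¹, ?_⟩
    calc _ = C ((c j - c i)⁻¹ * (c j - c i)) := by rw [C_mul, C_sub]; ring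
      _ = 1 := by rw [inv_mul_cancel₀ hne, C_1]
  · intro i hi
    rw [← he i hi, pow_mul, C_pow]
    exact sub_dvd_pow_sub_pow _ _ _

open Polynomial in
theorem mul_eval_derivative_prod_X_pow_sub_C {ι : Type*} [DecidableEq ι] {I : Finset ι}
    {c : ι → F} {N : ℕ} (hN : 1 ≤ N) {x : F} {i : ι} (hi : i ∈ I) (hx : x ^ N = c i) :
    x * eval x (derivative (∏ j ∈ I, (X ^ N - C (c j)))) =
      N * c i * ∏ j ∈ I.erase i, (c i - c j) := by
  rw [derivative_prod_finset, eval_finsetSum, sum_eq_single_of_mem i hi]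
  · obtain ⟨m, rfl⟩ : ∃ m, N = m + 1 := ⟨N - 1, by omega⟩
    simp only [eval_mul, eval_prod, derivative_sub, derivative_X_pow, derivative_C, eval_sub,
      eval_pow, eval_X, eval_C, hx, sub_zero, eval_natCast, Nat.add_sub_cancel, C_eq_natCast]
    rw [← hx, pow_succ]
    ring
  · intro j _ hji
    rw [eval_mul, eval_prod, prod_eq_zero (mem_erase.2 ⟨hji.symm, hi⟩) (by simp [hx]), zero_mul]

open Polynomial in
theorem delta_eq_eval_derivative {n : ℕ} (x : Fin n → F) (i : Fin n) :
    delta x i = eval (x i) (derivative (Lagrange.nodal univ x)) := by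
  rw [Lagrange.eval_nodal_derivative_eval_node_eq (mem_univ i), Lagrange.eval_nodal, delta]

open Polynomial in
/-- A monic divisor `P` of `X ^ (q - 1) - 1` with `-x * P'(x)` a square at each root `x` yields an almost
self-dual code. -/
theorem exists_almostSelfDual_of_isSquare [Fintype F] {P : F[X]} {n : ℕ} (hn : Even n)
    (hn0 : 1 ≤ n) (hP : P.Monic) (hdeg : P.natDegree = n) (hdvd : P ∣ X ^ (Fintype.card F - 1) - 1)
    (hsq : ∀ x, P.eval x = 0 → IsSquare (-(x * eval x (derivative P)))) :
    ∃ C : Submodule F (Fin (n + 1) → F), IsMDSCode C (n / 2) ∧ C ≤ dualCode C ∧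
      Module.finrank F (dualCode C) = Module.finrank F C + 1 := by
  have hcard : Fintype.card F = Fintype.card F - 1 + 1 := by have := Fintype.card_pos (α := F); omega
  have hdvd' : P ∣ X ^ Fintype.card F - X := by
    refine hdvd.trans ⟨X, ?_⟩
    conv_lhs => rw [hcard]
    ring
  obtain ⟨x, hx, hxP⟩ := exists_injective_nodal_eq hP hdeg hdvd'
  have hroot : ∀ i, P.eval (x i) = 0 := fun i => by
    rw [← hxP, Lagrange.eval_nodal_at_node (mem_univ i)]
  have hx0 : ∀ i, x i ≠ 0 := by
    intro i h
    have := eval_dvd (x := x i) hdvd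
    have h1 : Fintype.card F - 1 ≠ 0 := by have := Fintype.one_lt_card (α := F); omega
    rw [hroot, h, zero_dvd_iff] at this
    simp [h1] at this
  have hdelta : ∀ i, delta x i ≠ 0 := fun i =>
    prod_ne_zero_iff.2 fun j hj => sub_ne_zero.2 fun h => (mem_erase.1 hj).1 (hx h).symm
  choose z hz using fun i => hsq (x i) (hroot i)
  simp only [← hxP, ← delta_eq_eval_derivative] at hz
  have hz0 : ∀ i, z i ≠ 0 := by
    intro i h
    have := hz i
    simp [h, hx0, hdelta] at this
  have hw : ∀ i, (z i / delta x i) ^ 2 * delta x i = -x i := by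
    intro i
    have := hdelta i
    field_simp
    rw [pow_two, ← hz i]
    ring
  obtain ⟨k, hk⟩ := hn
  have hk2 : n / 2 = k := by omega
  rw [hk2]
  have hmds := GRSext_isMDSCode (F := F) (n := n) (k := k) (by omega) (by omega) hx
    (fun i => div_ne_zero (hz0 i) (hdelta i))
  refine ⟨_, hmds, GRSext_le_dualCode_s17 (by omega) (by omega) hx hw, ?_⟩
  have := finrank_add_finrank_dualCode (GRSext k x fun i => z i / delta x i)
  have := hmds.1
  omega

theorem FiniteField.isSquare_of_pow_eq_one [Fintype F] {r h : ℕ} (hF : Fintype.card F = r ^ 2)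
    (hrh : r + 1 = 2 * h) {z : F} (hz : z ^ ((r - 1) * h) = 1) : IsSquare z := by
  obtain ⟨m, rfl⟩ : ∃ m, h = m + 1 := ⟨h - 1, by have := hF ▸ Fintype.card_pos (α := F); omega⟩
  obtain rfl : r = 2 * m + 1 := by omega
  have hcard : Fintype.card F = 2 * (2 * m * (m + 1)) + 1 := by rw [hF]; ring
  have hchar : ringChar F ≠ 2 := by
    rw [Ne, FiniteField.even_card_iff_char_two]
    omega
  rcases eq_or_ne z 0 with rfl | h0
  · exact IsSquare.zero
  · rw [FiniteField.isSquare_iff hchar h0, hcard]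
    convert hz using 2
    simp only [Nat.add_sub_cancel]
    omega

theorem FiniteField.sub_pow_of_card_eq_sq [Fintype F] {r : ℕ} (hF : Fintype.card F = r ^ 2)
    (hr : IsPrimePow r) (u v : F) : (u - v) ^ r = u ^ r - v ^ r := by
  obtain ⟨p, k, hp, -, rfl⟩ := hr
  have : Fact p.Prime := ⟨hp.nat_prime⟩
  have : CharP F p := charP_of_card_eq_prime_pow (f := k * 2) (by rw [hF, pow_mul])
  exact sub_pow_char_pow u v k

theorem FiniteField.natCast_pow_of_card_eq_sq [Fintype F] {r : ℕ} (hF : Fintype.card F = r ^ 2)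
    (hr : IsPrimePow r) (n : ℕ) : (n : F) ^ r = n := by
  obtain ⟨p, k, hp, -, rfl⟩ := hr
  have : Fact p.Prime := ⟨hp.nat_prime⟩
  have : CharP F p := charP_of_card_eq_prime_pow (f := k * 2) (by rw [hF, pow_mul])
  rw [← iterateFrobenius_def, map_natCast]

/-- The difference of two distinct elements of norm one. -/
theorem FiniteField.sub_pow_of_pow_add_one_eq_one [Fintype F] {r h : ℕ}
    (hF : Fintype.card F = r ^ 2) (hr : IsPrimePow r) (hh : Odd h) {u v : F} (huv : u ≠ v)
    (hu : u ^ (r + 1) = 1) (hv : v ^ (r + 1) = 1) :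
    (u - v) ^ ((r - 1) * h) * (u ^ h * v ^ h) = -1 := by
  have hd : u - v ≠ 0 := sub_ne_zero.2 huv
  have hr1 : r - 1 + 1 = r := Nat.sub_add_cancel hr.one_lt.le
  have key : (u - v) ^ (r - 1) * (u * v) = -1 := by
    apply mul_right_cancel₀ hd
    calc (u - v) ^ (r - 1) * (u * v) * (u - v)
        = (u - v) ^ (r - 1 + 1) * (u * v) := by ring
      _ = u ^ (r + 1) * v - v ^ (r + 1) * u := by
          rw [hr1, FiniteField.sub_pow_of_card_eq_sq hF hr]; ring
      _ = -1 * (u - v) := by rw [hu, hv]; ring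
  rw [pow_mul, ← mul_pow, ← mul_pow, key, hh.neg_one_pow]

theorem FiniteField.sub_pow_sub_one_eq_one [Fintype F] {r : ℕ}
    (hF : Fintype.card F = r ^ 2) (hr : IsPrimePow r) {u v : F} (huv : u ≠ v)
    (hu : u ^ (r - 1) = 1) (hv : v ^ (r - 1) = 1) : (u - v) ^ (r - 1) = 1 := by
  have hr1 : r - 1 + 1 = r := Nat.sub_add_cancel hr.one_lt.le
  apply mul_right_cancel₀ (sub_ne_zero.2 huv)
  rw [← pow_succ, hr1, FiniteField.sub_pow_of_card_eq_sq hF hr, one_mul, ← hr1, pow_succ, pow_succ,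
    hu, hv, one_mul, one_mul]

theorem FiniteField.exists_isPrimitiveRoot [Fintype F] {d : ℕ} (hd : d ∣ Fintype.card F - 1) :
    ∃ ζ : F, IsPrimitiveRoot ζ d := by
  classical
  obtain ⟨g, hg⟩ := IsCyclic.exists_ofOrder_eq_natCard (α := Fˣ)
  rw [Nat.card_eq_fintype_card, Fintype.card_units] at hg
  obtain ⟨e, he⟩ := hd
  have h1 : 0 < Fintype.card F - 1 := by have := Fintype.one_lt_card (α := F); omega
  refine ⟨((g ^ e : Fˣ) : F), IsPrimitiveRoot.coe_units_iff.2 ?_⟩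
  exact (IsPrimitiveRoot.orderOf g).pow (hg ▸ h1) (by rw [hg, he, mul_comm])

open Polynomial in
theorem exists_almostSelfDual_of_roots [Fintype F] {r h : ℕ}
    (hF : Fintype.card F = r ^ 2) (hr : IsPrimePow r) (hh : Odd h) (hrh : r + 1 = 2 * h)
    {M N a b a' b' l m s t : ℕ} (hM : M * a = (r - 1) * h) (hN : N * b = (r - 1) * h)
    {ω τ ρ : F} (hω : IsPrimitiveRoot ω a') (hτ : IsPrimitiveRoot τ b')
    (ha'h : a' ∣ h) (ha'a : a' ∣ a) (ha'l : a' ∣ l)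
    (hb'r : b' ∣ r - 1) (hb'b : b' ∣ b) (hb'm : b' ∣ m)
    (hρr : ρ ^ (r - 1) = 1) (hρb : ρ ^ b = -1) (hρm : ρ ^ m = -1)
    (hNM : N * (r - 1) = M * l) (hMN : M * h = N * m)
    (hs : Odd s) (hsa : s ≤ a') (htb : t ≤ b') (heven : Even (s * M + t * N)) :
    ∃ C : Submodule F (Fin (s * M + t * N + 1) → F),
      IsMDSCode C ((s * M + t * N) / 2) ∧ C ≤ dualCode C ∧
      Module.finrank F (dualCode C) = Module.finrank F C + 1 := by
  have hr1 : 0 < r - 1 := Nat.sub_pos_of_lt hr.one_lt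
  have hE : 0 < (r - 1) * h := Nat.mul_pos hr1 hh.pos
  have hM1 : 1 ≤ M := Nat.pos_of_mul_pos_right (hM ▸ hE)
  have hN1 : 1 ≤ N := Nat.pos_of_mul_pos_right (hN ▸ hE)
  have hcard : Fintype.card F - 1 = (r - 1) * h + (r - 1) * h := by
    rw [hF, ← two_mul, mul_left_comm, ← hrh]
    obtain ⟨k, hk⟩ : ∃ k, r = k + 1 := ⟨r - 1, by omega⟩
    rw [hk, Nat.add_sub_cancel]
    exact Nat.sub_eq_of_eq_add (by ring)
  have hcast : ∀ K : ℕ, K ∣ (r - 1) * h → (K : F) ≠ 0 := by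
    rintro K ⟨d, hd⟩ h0
    have h1 : ((Fintype.card F - 1 : ℕ) : F) = 0 := by rw [hcard, hd]; push_cast; rw [h0]; ring
    rw [Nat.cast_sub Fintype.card_pos, Nat.cast_card_eq_zero] at h1
    simp at h1
  have hcastpow : ∀ K : ℕ, K ∣ (r - 1) * h → (K : F) ^ (r - 1) = 1 := by
    intro K hK
    apply mul_right_cancel₀ (hcast K hK)
    rw [← pow_succ, Nat.sub_add_cancel hr.one_lt.le,
      FiniteField.natCast_pow_of_card_eq_sq hF hr, one_mul]
  have hωh : ∀ i, (ω ^ i) ^ h = 1 := fun i => by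
    rw [pow_right_comm, (hω.pow_eq_one_iff_dvd h).2 ha'h, one_pow]
  have hτr : ∀ j, (ρ * τ ^ j) ^ (r - 1) = 1 := fun j => by
    rw [mul_pow, hρr, pow_right_comm, (hτ.pow_eq_one_iff_dvd _).2 hb'r, one_pow, one_mul]
  have hρ0 : ρ ≠ 0 := by rintro rfl; simp [hr1.ne'] at hρr
  have hωinj : Set.InjOn (fun i => ω ^ i) (range s : Set ℕ) := fun i hi j hj hij =>
    hω.pow_inj ((mem_range.1 hi).trans_le hsa) ((mem_range.1 hj).trans_le hsa) hij
  have hτinj : Set.InjOn (fun j => ρ * τ ^ j) (range t : Set ℕ) := fun i hi j hj hij =>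
    hτ.pow_inj ((mem_range.1 hi).trans_le htb) ((mem_range.1 hj).trans_le htb)
      (mul_left_cancel₀ hρ0 hij)
  set P : F[X] := ∏ i ∈ range s, (X ^ M - C (ω ^ i)) with hPdef
  set Q : F[X] := ∏ j ∈ range t, (X ^ N - C (ρ * τ ^ j)) with hQdef
  have hPm : P.Monic := monic_prod_of_monic _ _ fun i _ => monic_X_pow_sub_C _ (by omega)
  have hQm : Q.Monic := monic_prod_of_monic _ _ fun i _ => monic_X_pow_sub_C _ (by omega)
  have hPdvd : P ∣ X ^ ((r - 1) * h) - C 1 := hM ▸ prod_X_pow_sub_C_dvd hωinj fun i _ => by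
    rw [pow_right_comm, (hω.pow_eq_one_iff_dvd _).2 ha'a, one_pow]
  have hQdvd : Q ∣ X ^ ((r - 1) * h) - C (-1) := hN ▸ prod_X_pow_sub_C_dvd hτinj fun j _ => by
    rw [mul_pow, hρb, pow_right_comm, (hτ.pow_eq_one_iff_dvd _).2 hb'b, one_pow, mul_one]
  refine exists_almostSelfDual_of_isSquare (P := P * Q) heven ?_ (hPm.mul hQm) ?_ ?_ ?_
  · have := Nat.mul_pos hs.pos hM1
    omega
  · rw [hPm.natDegree_mul hQm, hPdef, hQdef,
      natDegree_prod_of_monic _ _ fun i _ => monic_X_pow_sub_C _ (by omega),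
      natDegree_prod_of_monic _ _ fun i _ => monic_X_pow_sub_C _ (by omega)]
    simp only [natDegree_X_pow_sub_C, sum_const, card_range, smul_eq_mul]
  · refine (mul_dvd_mul hPdvd hQdvd).trans (dvd_of_eq ?_)
    rw [hcard, C_neg, C_1]
    ring
  · intro x hx
    apply FiniteField.isSquare_of_pow_eq_one hF hrh
    have hEeven : Even ((r - 1) * h) := by
      have : Even (r - 1) := by
        obtain ⟨k, hk⟩ := hh
        exact ⟨2 * k, by omega⟩
      exact this.mul_right h
    rw [hEeven.neg_pow]
    by_cases hPx : P.eval x = 0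
    · obtain ⟨i, hi, hxi⟩ : ∃ i ∈ range s, x ^ M = ω ^ i := by
        rw [hPdef, eval_prod, prod_eq_zero_iff] at hPx
        obtain ⟨i, hi, hxi⟩ := hPx
        exact ⟨i, hi, sub_eq_zero.1 (by simpa using hxi)⟩
      have hQx : Q.eval x ≠ 0 := by
        intro hQx
        have h1 := eval_dvd (x := x) hPdvd
        have h2 := eval_dvd (x := x) hQdvd
        rw [hPx, zero_dvd_iff] at h1
        rw [hQx, zero_dvd_iff] at h2
        have h3 : ((2 : ℕ) : F) ≠ 0 := hcast 2 hEeven.two_dvd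
        apply h3
        simp only [eval_sub, eval_pow, eval_X, eval_C] at h1 h2
        push_cast
        linear_combination h2 - h1
      have hxN : (x ^ N) ^ (r - 1) = 1 := by
        rw [← pow_mul, hNM, pow_mul, hxi, pow_right_comm, (hω.pow_eq_one_iff_dvd _).2 ha'l, one_pow]
      have hder : x * eval x (derivative (P * Q)) =
          (M * ω ^ i * ∏ j ∈ (range s).erase i, (ω ^ i - ω ^ j)) * Q.eval x := by
        rw [← mul_eval_derivative_prod_X_pow_sub_C hM1 hi hxi, derivative_mul, eval_add, eval_mul,
          eval_mul, hPx]
        ring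
      have hQpow : Q.eval x ^ (r - 1) = 1 := by
        rw [hQdef, eval_prod, ← prod_pow]
        refine prod_eq_one fun j hj => ?_
        have hne : x ^ N ≠ ρ * τ ^ j := by
          intro he
          apply hQx
          rw [hQdef, eval_prod]
          exact prod_eq_zero hj (by simp [he])
        simpa using FiniteField.sub_pow_sub_one_eq_one hF hr hne hxN (hτr j)
      have hprod : (∏ j ∈ (range s).erase i, (ω ^ i - ω ^ j)) ^ ((r - 1) * h) = 1 := by
        rw [← prod_pow, prod_congr rfl (g := fun _ => (-1 : F))]
        · rw [prod_const, card_erase_of_mem hi, card_range]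
          exact (Nat.Odd.sub_odd hs odd_one).neg_one_pow
        · intro j hj
          have hne : ω ^ i ≠ ω ^ j := fun he =>
            (mem_erase.1 hj).1 (hωinj hi (mem_of_mem_erase hj) he).symm
          have hnorm : ∀ k, (ω ^ k) ^ (r + 1) = 1 := fun k => by
            rw [hrh, mul_comm, pow_mul, hωh, one_pow]
          have := FiniteField.sub_pow_of_pow_add_one_eq_one hF hr hh hne (hnorm i) (hnorm j)
          rwa [hωh, hωh, mul_one, mul_one] at this
      rw [hder, mul_pow, mul_pow, mul_pow, hprod, pow_mul (Q.eval x), hQpow, one_pow,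
        pow_mul (M : F), hcastpow M ⟨a, hM.symm⟩, one_pow, mul_comm, mul_comm (r - 1), pow_mul,
        hωh, one_pow]
      ring
    · have hQx : Q.eval x = 0 := by
        rw [eval_mul] at hx
        exact (mul_eq_zero.1 hx).resolve_left hPx
      obtain ⟨j, hj, hxj⟩ : ∃ j ∈ range t, x ^ N = ρ * τ ^ j := by
        rw [hQdef, eval_prod, prod_eq_zero_iff] at hQx
        obtain ⟨j, hj, hxj⟩ := hQx
        exact ⟨j, hj, sub_eq_zero.1 (by simpa using hxj)⟩
      have hxM : (x ^ M) ^ h = -1 := by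
        rw [← pow_mul, hMN, pow_mul, hxj, mul_pow, hρm, pow_right_comm,
          (hτ.pow_eq_one_iff_dvd _).2 hb'm, one_pow, mul_one]
      have hder : x * eval x (derivative (P * Q)) =
          (N * (ρ * τ ^ j) * ∏ k ∈ (range t).erase j, (ρ * τ ^ j - ρ * τ ^ k)) * P.eval x := by
        rw [← mul_eval_derivative_prod_X_pow_sub_C (c := fun k => ρ * τ ^ k) hN1 hj hxj,
          derivative_mul, eval_add, eval_mul, eval_mul, hQx]
        ring
      have hPpow : P.eval x ^ ((r - 1) * h) = 1 := by
        rw [hPdef, eval_prod, ← prod_pow]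
        refine prod_eq_one fun i hi => ?_
        have hne : x ^ M ≠ ω ^ i := by
          intro he
          apply hPx
          rw [hPdef, eval_prod]
          exact prod_eq_zero hi (by simp [he])
        have := FiniteField.sub_pow_of_pow_add_one_eq_one hF hr hh hne
          (by rw [hrh, mul_comm, pow_mul, hxM, neg_one_sq])
          (by rw [hrh, mul_comm, pow_mul, hωh, one_pow])
        rw [hωh, hxM] at this
        simp only [eval_sub, eval_pow, eval_X, eval_C]
        linear_combination -this
      have hprod : (∏ k ∈ (range t).erase j, (ρ * τ ^ j - ρ * τ ^ k)) ^ (r - 1) = 1 := by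
        rw [← prod_pow]
        refine prod_eq_one fun k hk => ?_
        exact FiniteField.sub_pow_sub_one_eq_one hF hr
          (fun he => (mem_erase.1 hk).1 (hτinj hj (mem_of_mem_erase hk) he).symm) (hτr j) (hτr k)
      rw [hder, mul_pow _ (P.eval x), hPpow, mul_one, pow_mul, mul_pow, mul_pow (N : F), hprod, hτr,
        hcastpow N ⟨b, hN.symm⟩]
      simp

/-- Theorem 4(i): `q = r²`, `r ≡ 1 (mod 4)`, `a, b` even divisors of `q-1`, `a ≡ 2 (mod 4)`,
`2a ∣ b(r+1)`, `2b ∣ a(r-1)`, `s` odd with `1 ≤ s ≤ a/gcd(a,b)`, `1 ≤ t ≤ b/gcd(a,b)`,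
`n = s(q-1)/a + t(q-1)/b`: there exists a `q`-ary MDS Euclidean almost self-dual code of
length `n + 1`, i.e. an `[n+1, n/2]` MDS code `C` with `C ⊆ C^⊥` and
`dim C^⊥ = dim C + 1`. -/
theorem stmt17 {F : Type*} [Field F] [Fintype F] {q r : ℕ} (hq : Fintype.card F = q)
    (hq2 : q = r ^ 2) (hpp : IsPrimePow r) (hr4 : r % 4 = 1)
    {a b : ℕ} (hae : Even a) (hbe : Even b) (ha : a ∣ q - 1) (hb : b ∣ q - 1)
    (ha4 : a % 4 = 2) (hab : 2 * a ∣ b * (r + 1)) (hba : 2 * b ∣ a * (r - 1))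
    {s t : ℕ} (hs : Odd s) (hs1 : 1 ≤ s) (hs2 : s ≤ a / Nat.gcd a b)
    (ht1 : 1 ≤ t) (ht2 : t ≤ b / Nat.gcd a b) :
    ∃ C : Submodule F (Fin (s * ((q - 1) / a) + t * ((q - 1) / b) + 1) → F),
      IsMDSCode C ((s * ((q - 1) / a) + t * ((q - 1) / b)) / 2) ∧ C ≤ dualCode C ∧
      Module.finrank F (dualCode C) = Module.finrank F C + 1 := by

  subst hq2
  obtain ⟨h, hrh⟩ : ∃ h, r + 1 = 2 * h := ⟨(r + 1) / 2, by omega⟩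
  have hh : Odd h := Nat.odd_iff.2 (by omega)
  have hr1 : 0 < r - 1 := Nat.sub_pos_of_lt hpp.one_lt
  have hE : 0 < (r - 1) * h := Nat.mul_pos hr1 hh.pos
  have hcard : r ^ 2 - 1 = 2 * ((r - 1) * h) := by
    rw [mul_left_comm, ← hrh]
    obtain ⟨k, hk⟩ : ∃ k, r = k + 1 := ⟨r - 1, by omega⟩
    rw [hk, Nat.add_sub_cancel]
    exact Nat.sub_eq_of_eq_add (by ring)
  generalize hM' : (r ^ 2 - 1) / a = M
  generalize hN' : (r ^ 2 - 1) / b = N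
  have hMa : M * a = 2 * ((r - 1) * h) := by rw [← hM', Nat.div_mul_cancel ha, hcard]
  have hNb : N * b = 2 * ((r - 1) * h) := by rw [← hN', Nat.div_mul_cancel hb, hcard]
  obtain ⟨A, rfl⟩ := hae.two_dvd
  obtain ⟨B, rfl⟩ := hbe.two_dvd
  have hM : M * A = (r - 1) * h := by linarith
  have hN : N * B = (r - 1) * h := by linarith
  have hA : Odd A := Nat.odd_iff.2 (by omega)
  have hB0 : 0 < B := Nat.pos_of_mul_pos_left (hN ▸ hE)
  have hG : 0 < Nat.gcd A B := Nat.gcd_pos_of_pos_left _ hA.pos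
  obtain ⟨a', ha'⟩ := Nat.gcd_dvd_left A B
  obtain ⟨b', hb'⟩ := Nat.gcd_dvd_right A B
  have hcop : Nat.Coprime a' b' := by
    have := Nat.coprime_div_gcd_div_gcd hG
    rwa [Nat.div_eq_of_eq_mul_right hG ha', Nat.div_eq_of_eq_mul_right hG hb'] at this
  rw [Nat.gcd_mul_left, Nat.mul_div_mul_left _ _ two_pos,
    Nat.div_eq_of_eq_mul_right hG ha'] at hs2
  rw [Nat.gcd_mul_left, Nat.mul_div_mul_left _ _ two_pos,
    Nat.div_eq_of_eq_mul_right hG hb'] at ht2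
  obtain ⟨m, hm⟩ := hab
  replace hm : B * h = A * m := by rw [hrh] at hm; linarith
  obtain ⟨l, hl⟩ := hba
  replace hl : A * (r - 1) = B * (2 * l) := by linarith
  have hm' : b' * h = a' * m := by
    apply Nat.eq_of_mul_eq_mul_left hG
    rw [← mul_assoc, ← mul_assoc, ← ha', ← hb', hm]
  have hl' : a' * (r - 1) = b' * (2 * l) := by
    apply Nat.eq_of_mul_eq_mul_left hG
    rw [← mul_assoc, ← mul_assoc, ← ha', ← hb', hl]
  have ha'h : a' ∣ h := hcop.dvd_of_dvd_mul_left ⟨m, hm'⟩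
  have ha'l : a' ∣ 2 * l := hcop.dvd_of_dvd_mul_left ⟨r - 1, hl'.symm⟩
  have hb'r : b' ∣ r - 1 := hcop.symm.dvd_of_dvd_mul_left ⟨2 * l, hl'⟩
  have hb'm : b' ∣ m := hcop.symm.dvd_of_dvd_mul_left ⟨h, hm'.symm⟩
  obtain ⟨v, β, hβ, hBv⟩ := Nat.exists_eq_two_pow_mul_odd hB0.ne'
  have hv : 2 ^ (v + 1) ∣ r - 1 := by
    refine (Nat.Coprime.pow_left (v + 1) hA.coprime_two_left).dvd_of_dvd_mul_left ⟨β * l, ?_⟩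
    rw [hl, hBv]
    ring
  obtain ⟨μ, hμ⟩ : 2 ^ v ∣ m := by
    refine (Nat.Coprime.pow_left v hA.coprime_two_left).dvd_of_dvd_mul_left ⟨β * h, ?_⟩
    rw [← hm, hBv]
    ring
  have hμodd : Odd μ := by
    have h1 : β * h = A * μ := by
      apply Nat.eq_of_mul_eq_mul_left (pow_pos two_pos v : 0 < 2 ^ v)
      rw [← mul_assoc, ← hBv, hm, hμ]
      ring
    exact (Nat.odd_mul.1 (h1 ▸ hβ.mul hh)).2
  have hMe : Even M := by
    have : Even (M * A) := hM ▸ (Nat.even_iff.2 (by omega : (r - 1) % 2 = 0)).mul_right h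
    exact (Nat.even_mul.1 this).resolve_right (Nat.not_even_iff_odd.2 hA)
  have hNe : Even N := by
    obtain ⟨c, hc⟩ := hv
    have h1 : N * β = 2 * (c * h) := by
      apply Nat.eq_of_mul_eq_mul_left (pow_pos two_pos v : 0 < 2 ^ v)
      rw [mul_left_comm, ← hBv, hN, hc]
      ring
    exact (Nat.even_mul.1 (h1 ▸ even_two_mul _)).resolve_right (Nat.not_even_iff_odd.2 hβ)
  have hrq : r - 1 ∣ Fintype.card F - 1 := by
    rw [hq, hcard]
    exact ⟨2 * h, by ring⟩
  have hhq : h ∣ Fintype.card F - 1 := by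
    rw [hq, hcard]
    exact ⟨2 * (r - 1), by ring⟩
  obtain ⟨ω, hω⟩ := FiniteField.exists_isPrimitiveRoot (ha'h.trans hhq)
  obtain ⟨τ, hτ⟩ := FiniteField.exists_isPrimitiveRoot (hb'r.trans hrq)
  obtain ⟨ρ, hρ⟩ := FiniteField.exists_isPrimitiveRoot (hv.trans hrq)
  have hρv : ρ ^ 2 ^ v = -1 :=
    (hρ.pow (pow_pos two_pos _) (pow_succ 2 v)).eq_neg_one_of_two_right
  refine exists_almostSelfDual_of_roots hq hpp hh hrh hM hN hω hτ ha'h (Dvd.intro_left _ ha'.symm)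
    ha'l hb'r (Dvd.intro_left _ hb'.symm) hb'm ((hρ.pow_eq_one_iff_dvd _).2 hv)
    (by rw [hBv, pow_mul, hρv, hβ.neg_one_pow]) (by rw [hμ, pow_mul, hρv, hμodd.neg_one_pow])
    ?_ ?_ hs hs2 ht2 ((hMe.mul_left s).add (hNe.mul_left t))
  · apply Nat.eq_of_mul_eq_mul_right hB0
    calc N * (r - 1) * B = (N * B) * (r - 1) := by ring
      _ = M * (A * (r - 1)) := by rw [hN, ← hM]; ring
      _ = M * (2 * l) * B := by rw [hl]; ring
  · apply Nat.eq_of_mul_eq_mul_right hA.pos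
    calc M * h * A = (M * A) * h := by ring
      _ = N * (B * h) := by rw [hM, ← hN]; ring
      _ = N * m * A := by rw [hm]; ring
end
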